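/- arXiv:1402.4688 — 2 statements merged into one kernel-verified Lean document; each statement's English description precedes it below -/
import Mathlib

section
/- Let σ > -1 and λ = d+1+σ, and equip the Bloch space with the seminorm ‖f‖_𝓑 = sup_{z∈B} (1-|z|²)|∇f(z)|, where ∇f(z) = (∂f/∂z_1, ..., ∂f/∂z_d) and |·| is the Euclidean norm on ℂ^d. Then the Bergman projection satisfies ‖T_σ‖_{L^∞(B) → 𝓑} = Γ(λ+1) / Γ((λ+1)/2)². -/
open MeasureTheory Complex Metric
open scoped ENNReal Classical

noncomputable section

abbrev Cd (d : ℕ) : Type := EuclideanSpace ℂ (Fin d)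

instance (d : ℕ) : MeasurableSpace (Cd d) := borel _
instance (d : ℕ) : BorelSpace (Cd d) := ⟨rfl⟩
noncomputable instance (d : ℕ) : MeasureSpace (Cd d) := measureSpaceOfInnerProductSpace

/-- The open unit ball of `ℂ^d`. -/
def unitBall (d : ℕ) : Set (Cd d) := Metric.ball 0 1

/-- Lebesgue measure on `ℂ^d`, normalized so that the unit ball has measure one. -/
def normVol (d : ℕ) : Measure (Cd d) := (volume (unitBall d))⁻¹ • volume

/-- The inner product `⟨z,w⟩ = ∑ z_j conj (w_j)`. -/
def herm {d : ℕ} (z w : Cd d) : ℂ := ∑ j, z j * (starRingEnd ℂ) (w j)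

/-- The normalizing constant `c_σ`. -/
def cCoef (d : ℕ) (σ : ℝ) : ℝ :=
  Real.Gamma (d + σ + 1) / (Real.Gamma (σ + 1) * Real.Gamma (d + 1))

/-- The Bergman kernel `K_σ(z,w) = (1-|w|²)^σ / (1-⟨z,w⟩)^{d+1+σ}`. -/
def bergKer (d : ℕ) (σ : ℝ) (z w : Cd d) : ℂ :=
  (((1 - ‖w‖ ^ 2 : ℝ) ^ σ : ℝ) : ℂ) / (1 - herm z w) ^ ((((d : ℝ) + 1 + σ : ℝ)) : ℂ)

/-- The Bergman projection `T_σ f (z) = c_σ ∫_B K_σ(z,w) f(w) dv(w)`. -/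
def bergman (d : ℕ) (σ : ℝ) (f : Cd d → ℂ) (z : Cd d) : ℂ :=
  (cCoef d σ : ℂ) * ∫ w in unitBall d, bergKer d σ z w * f w ∂(normVol d)

/-- The complex partial derivative `∂/∂z_j`. -/
def pd (d : ℕ) (j : Fin d) (f : Cd d → ℂ) : Cd d → ℂ :=
  fun z => fderiv ℂ f z (EuclideanSpace.single j 1)

/-- The complex partial derivative `∂^α` for a multi-index `α`. -/
def mpd (d : ℕ) (α : Fin d → ℕ) (f : Cd d → ℂ) : Cd d → ℂ :=
  (List.finRange d).foldr (fun j g => (pd d j)^[α j] g) f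

/-- Multi-indices `α ∈ ℤ₊^d` with `|α| = n`; there are `d̃ = (n+d-1).choose (d-1)` of them. -/
def MIdx (d n : ℕ) : Type := {α : Fin d → ℕ // ∑ j, α j = n}

instance (d n : ℕ) : Fintype (MIdx d n) :=
  Fintype.subtype (Finset.Nat.antidiagonalTuple d n)
    (fun _ => Finset.Nat.mem_antidiagonalTuple)

/-- `𝒟_z f (z) = (∂^α f(z))_{|α|=n} ∈ ℂ^{d̃}`. -/
def Dmap (d n : ℕ) (f : Cd d → ℂ) (z : Cd d) : MIdx d n → ℂ := fun α => mpd d α.1 f z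

/-- `Z(ζ) = (ζ^α)_{|α|=n} ∈ ℂ^{d̃}`. -/
def Zmap (d n : ℕ) (ζ : Cd d) : MIdx d n → ℂ := fun α => ∏ j, ζ j ^ α.1 j

/-- The Bloch seminorm `‖f‖_𝓑 = sup_{z∈B} (1-|z|²)^n |𝒟_z f(z)|` w.r.t. a norm `N` on `ℂ^{d̃}`. -/
def blochSemi (d n : ℕ) (N : (MIdx d n → ℂ) → ℝ) (f : Cd d → ℂ) : ℝ :=
  ⨆ z : unitBall d, (1 - ‖(z : Cd d)‖ ^ 2) ^ n * N (Dmap d n f z)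

/-- The seminorm of `T_σ : L^∞(B) → 𝓑`, i.e. `sup_{‖G‖_∞ ≤ 1} ‖T_σ G‖_𝓑`. -/
def opSemi (d n : ℕ) (σ : ℝ) (N : (MIdx d n → ℂ) → ℝ) : ℝ :=
  ⨆ G : {G : Cd d → ℂ // Measurable G ∧ ∀ w, ‖G w‖ ≤ 1},
    blochSemi d n N (bergman d σ G.1)

/-- `𝓒 = max_{|ζ|=1} |Z(ζ)|`. -/
def maxC (d n : ℕ) (N : (MIdx d n → ℂ) → ℝ) : ℝ :=
  ⨆ ζ : Metric.sphere (0 : Cd d) 1, N (Zmap d n (ζ : Cd d))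

/-- The Möbius automorphism `φ_z` of the unit ball, with `φ_0 = -id`. -/
def moebius (d : ℕ) (z ω : Cd d) : Cd d :=
  if z = 0 then -ω
  else (1 - herm ω z)⁻¹ •
    (z - (herm ω z / ((‖z‖ ^ 2 : ℝ) : ℂ)) • z
       - ((Real.sqrt (1 - ‖z‖ ^ 2) : ℝ) : ℂ) • (ω - (herm ω z / ((‖z‖ ^ 2 : ℝ) : ℂ)) • z))

end



lemma bp_finrank (d : ℕ) : Module.finrank ℝ (Cd d) = 2 * d := by
  rw [finrank_real_of_complex]; simp

lemma bp_polar (d : ℕ) (hd : 0 < d) (μ : Measure (Cd d)) [μ.IsAddHaarMeasure] (n : ℕ) (i : Fin d) :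
    ∃ S : ℝ, ∀ g : ℝ → ℝ, ∫ w, ‖w i‖ ^ (2 * n) * g ‖w‖ ∂μ =
      S * ∫ y in Set.Ioi (0:ℝ), y ^ (2 * n + 2 * d - 1) * g y := by
  refine ⟨∫ x : sphere (0 : Cd d) 1, ‖x.1 i‖ ^ (2 * n) ∂μ.toSphere, fun g => ?_⟩
  calc
    ∫ w, ‖w i‖ ^ (2 * n) * g ‖w‖ ∂μ
      = ∫ x : ({(0)}ᶜ : Set (Cd d)), ‖x.1 i‖ ^ (2 * n) * g (‖x.1‖) ∂(μ.comap (↑)) := by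
      rw [integral_subtype_comap (measurableSet_singleton _).compl
        fun x : Cd d ↦ ‖x i‖ ^ (2 * n) * g (‖x‖)]
      have : Nontrivial (Cd d) := by
        have : Nonempty (Fin d) := ⟨⟨0, hd⟩⟩
        infer_instance
      rw [restrict_compl_singleton]
    _ = ∫ x, ‖x.1.1 i‖ ^ (2 * n) * (x.2.1 ^ (2 * n) * g x.2.1)
          ∂μ.toSphere.prod (.volumeIoiPow (Module.finrank ℝ (Cd d) - 1)) := by
      rw [← μ.measurePreserving_homeomorphUnitSphereProd.integral_comp
        (Homeomorph.measurableEmbedding _)]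
      refine integral_congr_ae (.of_forall fun x => ?_)
      have hx : ‖(x : Cd d)‖ ≠ 0 := norm_ne_zero_iff.2 x.2
      simp only [homeomorphUnitSphereProd_apply_snd_coe, homeomorphUnitSphereProd_apply_fst_coe]
      simp only [PiLp.smul_apply, norm_smul, norm_inv, norm_norm]
      rw [← mul_assoc, ← mul_pow]
      congr 2
      field_simp
    _ = (∫ x : sphere (0 : Cd d) 1, ‖x.1 i‖ ^ (2 * n) ∂μ.toSphere) *
        ∫ x : Set.Ioi (0:ℝ), (x.1 ^ (2 * n) * g x.1) ∂.volumeIoiPow (Module.finrank ℝ (Cd d) - 1) := by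
      rw [← integral_prod_mul]
    _ = _ := by
      congr 1
      simp only [Measure.volumeIoiPow, ENNReal.ofReal]
      rw [integral_withDensity_eq_integral_smul,
        integral_subtype_comap measurableSet_Ioi fun a ↦
          Real.toNNReal (a ^ (Module.finrank ℝ (Cd d) - 1)) • (a ^ (2 * n) * g a),
        setIntegral_congr_fun measurableSet_Ioi fun x hx ↦ ?_]
      · rw [NNReal.smul_def, Real.coe_toNNReal _ (pow_nonneg (Set.mem_Ioi.1 hx).le _), smul_eq_mul, ← mul_assoc,
          ← pow_add, bp_finrank]
        congr 2
        omega
      · exact (measurable_subtype_coe.pow_const _).real_toNNReal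

lemma bp_radial_gauss (m : ℕ) (hm : 0 < m) :
    ∫ y in Set.Ioi (0:ℝ), y ^ (2 * m - 1) * Real.exp (- y ^ 2) = Real.Gamma m / 2 := by
  have := _root_.integral_rpow_mul_exp_neg_rpow (p := 2) (q := 2 * m - 1) (by norm_num)
    (by have : (0:ℝ) < m := by exact_mod_cast hm
        linarith)
  have e : ((2 * m - 1 : ℝ)) = ((2 * m - 1 : ℕ) : ℝ) := by
    rw [Nat.cast_sub (by omega)]; push_cast; ring
  have e2 : (2 * (m:ℝ) - 1 + 1) / 2 = m := by ring
  rw [e2, e] at this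
  rw [div_eq_inv_mul, ← one_div, ← this]
  refine setIntegral_congr_fun measurableSet_Ioi fun x hx => ?_
  simp only [Real.rpow_natCast, Real.rpow_two]

lemma bp_radial_beta (m : ℕ) (hm : 0 < m) (σ : ℝ) (hσ : -1 < σ) :
    ∫ y in Set.Ioi (0:ℝ), y ^ (2 * m - 1) * (if y < 1 then (1 - y ^ 2) ^ σ else 0) =
      Real.Gamma m * Real.Gamma (σ + 1) / Real.Gamma (m + σ + 1) / 2 := by
  have hm' : (0:ℝ) < m := by exact_mod_cast hm
  have h1 := integral_comp_rpow_Ioi_of_pos (p := 2)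
    (g := fun t : ℝ => if t < 1 then t ^ ((m:ℝ) - 1) * (1 - t) ^ ((σ + 1) - 1) else 0) (by norm_num)
  have h2 : ∫ y in Set.Ioi (0:ℝ), (if y < 1 then y ^ ((m:ℝ) - 1) * (1 - y) ^ ((σ + 1) - 1) else 0)
      = Real.Gamma m * Real.Gamma (σ + 1) / Real.Gamma (m + σ + 1) := by
    have hb := Complex.betaIntegral_eq_Gamma_mul_div (m : ℝ) ((σ + 1 : ℝ)) (by simpa using hm)
      (by simp; linarith)
    rw [← Complex.ofReal_add, Complex.Gamma_ofReal, Complex.Gamma_ofReal, Complex.Gamma_ofReal,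
      ← add_assoc] at hb
    rw [Complex.betaIntegral, intervalIntegral.integral_of_le zero_le_one,
      integral_Ioc_eq_integral_Ioo] at hb
    apply Complex.ofReal_injective
    push_cast
    rw [← hb, ← integral_complex_ofReal, ← Set.Ioi_inter_Iio, ← setIntegral_indicator measurableSet_Iio]
    refine setIntegral_congr_fun measurableSet_Ioi fun x hx => ?_
    have hx : 0 < x := hx
    by_cases h : x < 1
    · simp only [h, if_true, Set.indicator, Set.mem_Iio]
      rw [Complex.ofReal_mul, Complex.ofReal_cpow hx.le, Complex.ofReal_cpow (by linarith)]
      push_cast; rfl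
    · simp [h, Set.indicator]
  rw [h2] at h1
  rw [← h1, eq_div_iff two_ne_zero, ← integral_mul_const]
  refine setIntegral_congr_fun measurableSet_Ioi fun x hx => ?_
  have hx : 0 < x := hx
  have e : x ^ (2:ℝ) < 1 ↔ x < 1 := by
    rw [Real.rpow_two]
    constructor
    · intro h; nlinarith
    · intro h; nlinarith
  simp only [e]
  by_cases h : x < 1
  · simp only [h, if_true, smul_eq_mul, add_sub_cancel_right]
    have h5 : (2 - 1 + 2 * ((m:ℝ) - 1)) = ((2 * m - 1 : ℕ) : ℝ) := by
      rw [Nat.cast_sub (by omega)]; push_cast; ring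
    have h6 : x ^ (2 * m - 1) = x ^ ((2:ℝ) - 1) * x ^ (2 * ((m:ℝ) - 1)) := by
      rw [← Real.rpow_add hx, h5, Real.rpow_natCast]
    rw [← Real.rpow_mul hx.le, Real.rpow_two, h6]
    ring
  · simp [h]

/-- product Haar measure -/
noncomputable def bpMu (d : ℕ) : Measure (Cd d) :=
  Measure.map ((EuclideanSpace.equiv (Fin d) ℂ).symm) (volume : Measure (Fin d → ℂ))

instance bpMu_haar (d : ℕ) : (bpMu d).IsAddHaarMeasure := by
  unfold bpMu
  exact (EuclideanSpace.equiv (Fin d) ℂ).symm.isAddHaarMeasure_map _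

lemma bp_gauss (d : ℕ) (n : ℕ) (i : Fin d) :
    ∫ w, ‖w i‖ ^ (2 * n) * Real.exp (- ‖w‖ ^ 2) ∂(bpMu d) = Real.pi ^ d * n.factorial := by
  have hemb : MeasurableEmbedding ((EuclideanSpace.equiv (Fin d) ℂ).symm : (Fin d → ℂ) → Cd d) :=
    ((EuclideanSpace.equiv (Fin d) ℂ).symm.toHomeomorph).measurableEmbedding
  unfold bpMu
  rw [hemb.integral_map]
  have h1 : ∀ x : Fin d → ℂ, ‖((EuclideanSpace.equiv (Fin d) ℂ).symm x : Cd d) i‖ ^ (2 * n) *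
      Real.exp (- ‖((EuclideanSpace.equiv (Fin d) ℂ).symm x : Cd d)‖ ^ 2) =
      ∏ j, (if j = i then ‖x j‖ ^ (2 * n) else 1) * Real.exp (- ‖x j‖ ^ 2) := by
    intro x
    rw [Finset.prod_mul_distrib, ← Real.exp_sum, EuclideanSpace.norm_sq_eq, Finset.sum_neg_distrib]
    simp
  simp_rw [h1]
  rw [integral_fintype_prod_volume_eq_prod (f := fun j (x : ℂ) =>
    (if j = i then ‖x‖ ^ (2 * n) else 1) * Real.exp (- ‖x‖ ^ 2))]
  have h2 : ∀ k : ℕ, ∫ x : ℂ, ‖x‖ ^ (2 * k) * Real.exp (- ‖x‖ ^ 2) = Real.pi * k.factorial := by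
    intro k
    have := Complex.integral_rpow_mul_exp_neg_rpow (p := 2) (q := ((2 * k : ℕ) : ℝ)) (by norm_num)
      (by have : (0:ℝ) ≤ ((2 * k : ℕ) : ℝ) := by positivity
          linarith)
    simp only [Real.rpow_natCast, Real.rpow_two] at this
    rw [this]
    have : (((2 * k : ℕ) : ℝ) + 2) / 2 = k + 1 := by push_cast; ring
    rw [this, Real.Gamma_nat_eq_factorial]
    ring
  have h3 : ∀ j, ∫ x : ℂ, (if j = i then ‖x‖ ^ (2 * n) else 1) * Real.exp (- ‖x‖ ^ 2) =
      Real.pi * (if j = i then (n.factorial : ℝ) else 1) := by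
    intro j
    by_cases h : j = i
    · simp [h, h2]
    · simpa [h] using h2 0
  simp_rw [h3]
  rw [Finset.prod_mul_distrib]
  simp

lemma bp_moment0 (d : ℕ) (n : ℕ) (i : Fin d) (σ : ℝ) (hσ : -1 < σ) :
    ∫ w, ‖w i‖ ^ (2 * n) * (if ‖w‖ < 1 then (1 - ‖w‖ ^ 2) ^ σ else 0) ∂(bpMu d) =
      Real.pi ^ d * n.factorial * Real.Gamma (σ + 1) / Real.Gamma (n + d + σ + 1) := by
  have hd : 0 < d := i.pos
  obtain ⟨S, hS⟩ := bp_polar d hd (bpMu d) n i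
  have h1 := hS (fun r => Real.exp (- r ^ 2))
  have h2 := hS (fun r => if r < 1 then (1 - r ^ 2) ^ σ else 0)
  rw [bp_gauss, ← mul_add, bp_radial_gauss _ (by omega)] at h1
  rw [← mul_add, bp_radial_beta _ (by omega) σ hσ] at h2
  rw [h2]
  push_cast at h1 ⊢
  have : Real.Gamma (n + d) ≠ 0 := (Real.Gamma_pos_of_pos (by positivity)).ne'
  rw [h1]
  ring


lemma bp_ball_ne_zero (d : ℕ) (μ : Measure (Cd d)) [μ.IsAddHaarMeasure] : μ (unitBall d) ≠ 0 :=
  (Metric.measure_ball_pos μ 0 one_pos).ne'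

lemma bp_ball_ne_top (d : ℕ) (μ : Measure (Cd d)) [μ.IsAddHaarMeasure] : μ (unitBall d) ≠ ⊤ :=
  measure_ball_lt_top.ne

lemma bp_normVol_eq (d : ℕ) : normVol d = (bpMu d (unitBall d))⁻¹ • bpMu d := by
  have h := Measure.isAddLeftInvariant_eq_smul (volume : Measure (Cd d)) (bpMu d)
  set k := Measure.addHaarScalarFactor (volume : Measure (Cd d)) (bpMu d)
  unfold normVol
  have h0 := bp_ball_ne_zero d (volume : Measure (Cd d))
  rw [h] at h0 ⊢
  have hk : (k : ℝ≥0∞) ≠ 0 := by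
    rintro hk
    apply h0
    have : k = 0 := by exact_mod_cast hk
    simp [this]
  have hsm : k • bpMu d = (k : ℝ≥0∞) • bpMu d := rfl
  rw [hsm, Measure.smul_apply, smul_eq_mul,
    ENNReal.mul_inv (Or.inl hk) (Or.inl ENNReal.coe_ne_top), smul_smul]
  congr 1
  rw [mul_right_comm, ENNReal.inv_mul_cancel hk ENNReal.coe_ne_top, one_mul]

noncomputable def bpNu (d : ℕ) (σ : ℝ) : Measure (Cd d) :=
  ((normVol d).restrict (unitBall d)).withDensity (fun w => ENNReal.ofReal ((1 - ‖w‖ ^ 2) ^ σ))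

lemma bp_dens_meas (d : ℕ) (σ : ℝ) : Measurable (fun w : Cd d => (1 - ‖w‖ ^ 2) ^ σ) :=
  ((measurable_const.sub (measurable_norm.pow_const 2)).pow_const σ)

lemma bp_ball_meas (d : ℕ) : MeasurableSet (unitBall d) := measurableSet_ball

lemma bp_dens_nonneg {d : ℕ} (σ : ℝ) {w : Cd d} (hw : w ∈ unitBall d) :
    0 ≤ (1 - ‖w‖ ^ 2) ^ σ := by
  have : ‖w‖ < 1 := by simpa [unitBall] using hw
  apply Real.rpow_nonneg
  nlinarith [norm_nonneg w]

lemma bp_nu_integral (d : ℕ) (σ : ℝ) {E : Type*} [NormedAddCommGroup E] [NormedSpace ℝ E]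
    (f : Cd d → E) :
    ∫ w, f w ∂(bpNu d σ) = ∫ w in unitBall d, (1 - ‖w‖ ^ 2) ^ σ • f w ∂(normVol d) := by
  unfold bpNu
  rw [integral_withDensity_eq_integral_toReal_smul (bp_dens_meas d σ).ennreal_ofReal
    (.of_forall fun _ => ENNReal.ofReal_lt_top)]
  refine setIntegral_congr_fun (bp_ball_meas d) fun w hw => ?_
  rw [ENNReal.toReal_ofReal (bp_dens_nonneg σ hw)]

lemma bp_nu_ball (d : ℕ) (σ : ℝ) : ∀ᵐ w ∂(bpNu d σ), ‖w‖ < 1 := by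
  apply (withDensity_absolutelyContinuous _ _).ae_le
  have := ae_restrict_mem (μ := normVol d) (bp_ball_meas d)
  filter_upwards [this] with w hw
  simpa [unitBall] using hw

lemma bp_nu_inv (d : ℕ) (σ : ℝ) {E : Type*} [NormedAddCommGroup E] [NormedSpace ℝ E]
    (U : Cd d ≃ₗᵢ[ℂ] Cd d) (f : Cd d → E) :
    ∫ w, f (U w) ∂(bpNu d σ) = ∫ w, f w ∂(bpNu d σ) := by
  let U' : Cd d ≃ₗᵢ[ℝ] Cd d := ⟨U.toLinearEquiv.restrictScalars ℝ, U.norm_map⟩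
  have h1 : MeasurePreserving (U' : Cd d → Cd d) volume volume := U'.measurePreserving
  have h2 : MeasurePreserving (U : Cd d → Cd d) (normVol d) (normVol d) :=
    h1.smul_measure _
  have h3 : MeasurableEmbedding (U : Cd d → Cd d) := U.toHomeomorph.measurableEmbedding
  rw [bp_nu_integral, bp_nu_integral,
    ← h2.setIntegral_preimage_emb h3 (fun w => (1 - ‖w‖ ^ 2) ^ σ • f w)]
  have : U ⁻¹' unitBall d = unitBall d := by
    ext w; simp [unitBall]
  simp [this]

lemma bp_herm_inner {d : ℕ} (z w : Cd d) : herm z w = inner ℂ w z := by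
  simp [herm, PiLp.inner_apply]

lemma bp_moment1 (d : ℕ) (n : ℕ) (i : Fin d) (σ : ℝ) (hσ : -1 < σ) :
    cCoef d σ * ∫ w, ‖w i‖ ^ (2 * n) ∂(bpNu d σ) =
      n.factorial * Real.Gamma (d + 1 + σ) / Real.Gamma (n + (d + 1 + σ)) := by
  have key : ∀ (n : ℕ) (σ : ℝ) (hσ : -1 < σ), ∫ w in unitBall d, (1 - ‖w‖ ^ 2) ^ σ • ‖w i‖ ^ (2 * n) ∂(bpMu d) =
      Real.pi ^ d * n.factorial * Real.Gamma (σ + 1) / Real.Gamma (n + d + σ + 1) := by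
    intro n σ hσ
    rw [← bp_moment0 d n i σ hσ, ← integral_indicator (bp_ball_meas d)]
    congr 1
    ext w
    by_cases h : ‖w‖ < 1
    · simp [Set.indicator, unitBall, h, mul_comm]
    · simp [Set.indicator, unitBall, h]
  have hB : (bpMu d (unitBall d)).toReal = Real.pi ^ d / Real.Gamma (d + 1) := by
    have := key 0 0 (by norm_num)
    simpa [Measure.real] using this
  rw [bp_nu_integral, bp_normVol_eq, Measure.restrict_smul, integral_smul_measure, key n σ hσ,
    ENNReal.toReal_inv, hB, cCoef]
  have h1 : Real.Gamma (σ + 1) ≠ 0 := (Real.Gamma_pos_of_pos (by linarith)).ne'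
  have h2 : Real.Gamma (d + 1) ≠ 0 := (Real.Gamma_pos_of_pos (by positivity)).ne'
  have e1 : (d : ℝ) + σ + 1 = d + 1 + σ := by ring
  have e2 : (n : ℝ) + d + σ + 1 = n + (d + 1 + σ) := by ring
  rw [e1, e2, smul_eq_mul]
  have : Real.pi ≠ 0 := Real.pi_ne_zero
  field_simp

lemma bp_c_pos (d : ℕ) (σ : ℝ) (hσ : -1 < σ) : 0 < cCoef d σ := by
  have : (0:ℝ) ≤ d := by positivity
  exact div_pos (Real.Gamma_pos_of_pos (by linarith))
    (mul_pos (Real.Gamma_pos_of_pos (by linarith)) (Real.Gamma_pos_of_pos (by linarith)))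

lemma bp_mass (d : ℕ) (hd : 0 < d) (σ : ℝ) (hσ : -1 < σ) :
    cCoef d σ * ∫ _w, (1:ℝ) ∂(bpNu d σ) = 1 := by
  have := bp_moment1 d 0 ⟨0, hd⟩ σ hσ
  have h2 : Real.Gamma (d + 1 + σ) ≠ 0 := (Real.Gamma_pos_of_pos (by
    have : (0:ℝ) ≤ d := by positivity
    linarith)).ne'
  simpa [h2] using this

lemma bp_finite (d : ℕ) (hd : 0 < d) (σ : ℝ) (hσ : -1 < σ) : IsFiniteMeasure (bpNu d σ) := by
  have h := bp_mass d hd σ hσ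
  have : Integrable (fun _ => (1:ℝ)) (bpNu d σ) := by
    by_contra hc
    rw [integral_undef hc] at h
    simp at h
  rwa [integrable_const_iff_isFiniteMeasure one_ne_zero] at this

lemma bp_moment (d : ℕ) (hd : 0 < d) (n : ℕ) (z : Cd d) (σ : ℝ) (hσ : -1 < σ) :
    cCoef d σ * ∫ w, ‖inner ℂ w z‖ ^ (2 * n) ∂(bpNu d σ) =
      ‖z‖ ^ (2 * n) * (n.factorial * Real.Gamma (d + 1 + σ) / Real.Gamma (n + (d + 1 + σ))) := by
  let i : Fin d := ⟨0, hd⟩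
  obtain ⟨e, he, hez⟩ : ∃ e : Cd d, ‖e‖ = 1 ∧ z = (‖z‖ : ℂ) • e := by
    by_cases hz : z = 0
    · exact ⟨EuclideanSpace.single i 1, by simp, by simp [hz]⟩
    · have : (‖z‖ : ℂ) ≠ 0 := by exact_mod_cast norm_ne_zero_iff.2 hz
      refine ⟨(‖z‖ : ℂ)⁻¹ • z, ?_, ?_⟩
      · rw [norm_smul]; simp [hz]
      · rw [smul_smul, mul_inv_cancel₀ this, one_smul]
  obtain ⟨b, hb⟩ : ∃ b : OrthonormalBasis (Fin d) ℂ (Cd d), b i = e := by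
    have ho : Orthonormal ℂ (({i} : Set (Fin d)).domRestrict (fun _ => e)) := by
      constructor
      · intro j; exact he
      · intro j k hjk; exact absurd (Subsingleton.elim j k) hjk
    obtain ⟨b, hb⟩ := ho.exists_orthonormalBasis_extension_of_card_eq (by simp)
    exact ⟨b, hb i rfl⟩
  have h1 : ∀ w, ‖inner ℂ w z‖ ^ (2 * n) = ‖z‖ ^ (2 * n) * ‖(b.repr w) i‖ ^ (2 * n) := by
    intro w
    rw [b.repr_apply_apply, hb, hez, inner_smul_right, norm_mul, ← hez, norm_inner_symm]
    simp [mul_pow]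
  simp_rw [h1]
  rw [integral_const_mul, bp_nu_inv d σ b.repr (fun w => ‖w i‖ ^ (2 * n)), mul_left_comm, bp_moment1 d n i σ hσ]

/-- orthogonality -/
lemma bp_orth (d : ℕ) (σ : ℝ) (z : Cd d) (m n : ℕ) (h : m ≠ n) :
    ∫ w, (inner ℂ w z) ^ m * (starRingEnd ℂ) (inner ℂ w z) ^ n ∂(bpNu d σ) = 0 := by
  set I := ∫ w, (inner ℂ w z : ℂ) ^ m * (starRingEnd ℂ) (inner ℂ w z) ^ n ∂(bpNu d σ) with hI
  let c : ℂ := Complex.exp (Complex.I * 1)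
  have hc : ‖c‖ = 1 := by simp [c, mul_comm Complex.I, Complex.norm_exp]
  have hcu : c ∈ unitary ℂ := by
    rw [Unitary.mem_iff]
    have : (starRingEnd ℂ) c * c = 1 := by
      rw [mul_comm, Complex.mul_conj, Complex.normSq_eq_norm_sq, hc]; simp
    exact ⟨this, by rw [mul_comm]; exact this⟩
  let U : Cd d ≃ₗᵢ[ℂ] Cd d := 
    ⟨LinearEquiv.smulOfNeZero ℂ (Cd d) c (by simp [c]), fun w => by simp [norm_smul, hc]⟩
  have hU : ∀ w, U w = c • w := fun w => rfl
  have h1 := bp_nu_inv d σ U (fun w => (inner ℂ w z : ℂ) ^ m * (starRingEnd ℂ) (inner ℂ w z) ^ n)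
  simp only [hU, inner_smul_left, map_mul, mul_pow, Complex.conj_conj] at h1
  have h2 : ((starRingEnd ℂ) c ^ m * c ^ n) * I = I := by
    rw [hI, ← integral_const_mul, ← h1]
    congr 1; ext w; ring
  have h3 : (starRingEnd ℂ) c ^ m * c ^ n ≠ 1 := by
    have : (starRingEnd ℂ) c = Complex.exp (-(Complex.I * 1)) := by
      simp [c, ← Complex.exp_conj]
    rw [this, ← Complex.exp_nat_mul, ← Complex.exp_nat_mul, ← Complex.exp_add]
    intro hh
    rw [Complex.exp_eq_one_iff] at hh
    obtain ⟨k, hk⟩ := hh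
    have hk' : ((n:ℂ) - m) = k * (2 * Real.pi) := by
      apply mul_right_cancel₀ Complex.I_ne_zero
      linear_combination hk
    have hk2 : ((n:ℝ) - m) = k * (2 * Real.pi) := by exact_mod_cast hk'
    have hk0 : k ≠ 0 := by
      rintro rfl
      apply h
      simp only [Int.cast_zero, zero_mul] at hk2
      have : (n:ℝ) = m := by linarith
      exact_mod_cast this.symm
    have hpi := irrational_pi
    apply hpi
    refine ⟨((n:ℚ) - m) / (2 * k), ?_⟩
    have : (k:ℝ) ≠ 0 := by exact_mod_cast hk0
    push_cast
    rw [hk2]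
    field_simp
  have h4 : ((starRingEnd ℂ) c ^ m * c ^ n - 1) * I = 0 := by rw [sub_mul, h2]; ring
  exact (mul_eq_zero.1 h4).resolve_left (sub_ne_zero.2 h3)


noncomputable def bpP (s : ℝ) (n : ℕ) : ℝ := ∏ j ∈ Finset.range n, (s + j)

lemma bpP_pos {s : ℝ} (hs : 0 < s) (n : ℕ) : 0 < bpP s n :=
  Finset.prod_pos fun j _ => by positivity

lemma bpP_succ (s : ℝ) (n : ℕ) : bpP s (n+1) = bpP s n * (s + n) := Finset.prod_range_succ _ _

lemma bpP_gamma {s : ℝ} (hs : 0 < s) (n : ℕ) : Real.Gamma (n + s) = bpP s n * Real.Gamma s := by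
  induction n with
  | zero => simp [bpP]
  | succ n ih =>
    rw [bpP_succ]
    have : ((n+1 : ℕ):ℝ) + s = (n + s) + 1 := by push_cast; ring
    rw [this, Real.Gamma_add_one (by positivity), ih]; ring

lemma bpP_choose (s : ℝ) (n : ℕ) :
    Ring.choose ((s:ℂ) + n - 1) n = ((bpP s n / n.factorial : ℝ) : ℂ) := by
  have h := Ring.factorial_nsmul_multichoose_eq_ascPochhammer (s:ℂ) n
  have h2 : Ring.choose ((s:ℂ) + n - 1) n = Ring.multichoose (s:ℂ) n := by
    simp only [Ring.choose]; congr 1; ring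
  have h3 : ∀ n, (ascPochhammer ℂ n).eval (s:ℂ) = ((bpP s n : ℝ) : ℂ) := by
    intro n
    induction n with
    | zero => simp [bpP]
    | succ n ih => rw [ascPochhammer_succ_eval, bpP_succ, ih]; push_cast; ring
  rw [h2]
  rw [Polynomial.ascPochhammer_smeval_eq_eval, h3, nsmul_eq_mul] at h
  have : (n.factorial : ℂ) ≠ 0 := by exact_mod_cast n.factorial_ne_zero
  push_cast
  field_simp
  linear_combination h

lemma bp_binom (s : ℝ) (u : ℂ) (hu : ‖u‖ < 1) :
    HasSum (fun n => ((bpP s n / n.factorial : ℝ) : ℂ) * u ^ n) (1 / (1 - u) ^ (s:ℂ)) := by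
  have h := (one_div_one_sub_cpow_hasFPowerSeriesOnBall_zero (s:ℂ)).hasSum (y := u)
    (by
      rw [Metric.mem_eball, edist_zero_right, ← ofReal_norm]
      exact ENNReal.ofReal_lt_one.2 hu)
  simpa [FormalMultilinearSeries.ofScalars_apply_eq, bpP_choose, mul_comm] using h

lemma bp_prod (f g : ℕ → ℂ) (A B : ℂ) (hf : HasSum f A) (hg : HasSum g B) :
    HasSum (fun p : ℕ × ℕ => f p.1 * g p.2) (A * B) :=
  hf.mul hg (summable_mul_of_summable_norm hf.summable.norm hg.summable.norm)

lemma bp_conj_sum (q : ℕ → ℝ) (u A : ℂ) (s1 : HasSum (fun n => (q n : ℂ) * u ^ n) A) :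
    HasSum (fun n => (q n : ℂ) * (starRingEnd ℂ) u ^ n) ((starRingEnd ℂ) A) := by
  have h := Complex.hasSum_conj'.2 s1
  have e : (fun n => (starRingEnd ℂ) ((q n : ℂ) * u ^ n)) =
      fun n => (q n : ℂ) * (starRingEnd ℂ) u ^ n := by
    ext n; simp
  rwa [e] at h

lemma bp_pt_val (a : ℝ) (u : ℂ) : (1 / (1 - u) ^ (a:ℂ)) * (starRingEnd ℂ) (1 / (1 - u) ^ (a:ℂ)) =
    ((‖1 - u‖ ^ (-(2 * a)) : ℝ) : ℂ) := by
  rw [Complex.mul_conj, Complex.normSq_eq_norm_sq, norm_div, norm_one,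
    Complex.norm_cpow_real, one_div, ← Real.rpow_neg (norm_nonneg _), ← Real.rpow_natCast,
    ← Real.rpow_mul (norm_nonneg _)]
  congr 2
  push_cast; ring

lemma bp_pointwise (a : ℝ) (q : ℕ → ℝ) (hq : q = fun n => bpP a n / n.factorial)
    (u : ℂ) (hu : ‖u‖ < 1) :
    HasSum (fun p : ℕ × ℕ => ((q p.1 : ℂ) * u ^ p.1) * ((q p.2 : ℂ) * (starRingEnd ℂ) u ^ p.2))
      ((‖1 - u‖ ^ (-(2 * a)) : ℝ) : ℂ) := by
  have s1 : HasSum (fun n => (q n : ℂ) * u ^ n) (1 / (1 - u) ^ (a:ℂ)) := by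
    rw [hq]; exact bp_binom a u hu
  rw [← bp_pt_val]
  have h := bp_prod (fun n => (q n : ℂ) * u ^ n) _ _ _ s1 (bp_conj_sum q u _ s1)
  exact h

lemma bp_binom_summable {s : ℝ} (hs : 0 < s) (r : ℝ) (h0 : 0 ≤ r) (hr : r < 1) :
    Summable (fun n => (bpP s n / n.factorial : ℝ) * r ^ n) := by
  have := (bp_binom s (r:ℂ) (by simpa [abs_of_nonneg h0] using hr)).summable
  have h2 := this.norm
  convert h2 using 2 with n
  have := (bpP_pos hs n).le
  rw [norm_mul, norm_pow, Complex.norm_real, Complex.norm_real, Real.norm_of_nonneg (by positivity),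
    Real.norm_of_nonneg h0]

noncomputable def bpB (lam : ℝ) (n : ℕ) : ℝ :=
  bpP ((lam + 1) / 2) n ^ 2 / (n.factorial * bpP lam n)

lemma bpB_pos {lam : ℝ} (h : 1 < lam) (n : ℕ) : 0 < bpB lam n := by
  have := bpP_pos (s := lam) (by linarith) n
  have := bpP_pos (s := (lam+1)/2) (by linarith) n
  unfold bpB; positivity

lemma bpB_mono {lam : ℝ} (h : 1 < lam) : Monotone (bpB lam) := by
  refine monotone_nat_of_le_succ fun n => ?_
  have h1 := bpP_pos (s := lam) (by linarith) n
  have h2 := bpP_pos (s := (lam+1)/2) (by linarith) n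
  have h3 := bpB_pos h n
  have e : bpB lam (n+1) = bpB lam n * (((lam+1)/2 + n)^2 / ((n+1) * (lam + n))) := by
    unfold bpB
    rw [bpP_succ, bpP_succ, Nat.factorial_succ]
    push_cast
    have : (n.factorial : ℝ) ≠ 0 := by exact_mod_cast n.factorial_ne_zero
    have : (lam + n) ≠ 0 := by positivity
    field_simp
  rw [e]
  apply le_mul_of_one_le_right h3.le
  rw [one_le_div (by positivity)]
  nlinarith [sq_nonneg (lam - 1)]

lemma bpB_tendsto {lam : ℝ} (h : 1 < lam) :
    Filter.Tendsto (bpB lam) Filter.atTop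
      (nhds (Real.Gamma lam / Real.Gamma ((lam + 1) / 2) ^ 2)) := by
  rw [← Filter.tendsto_add_atTop_iff_nat 1]
  have h1 := Real.GammaSeq_tendsto_Gamma lam
  have h2 := Real.GammaSeq_tendsto_Gamma ((lam + 1) / 2)
  have hg : Real.Gamma ((lam+1)/2) ^ 2 ≠ 0 := by
    have := Real.Gamma_pos_of_pos (s := (lam+1)/2) (by linarith)
    positivity
  have h3 := (tendsto_natCast_div_add_atTop (1:ℝ)).mul (h1.div (h2.pow 2) hg)
  rw [one_mul] at h3
  refine h3.congr' ?_
  filter_upwards [Filter.eventually_gt_atTop 0] with n hn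
  have hn' : (0:ℝ) < n := by exact_mod_cast hn
  have p1 := bpP_pos (s := lam) (by linarith) (n+1)
  have p2 := bpP_pos (s := (lam+1)/2) (by linarith) (n+1)
  simp only [Pi.div_apply, Real.GammaSeq, bpB]
  change (n:ℝ) / (n + 1) * ((n:ℝ) ^ lam * n.factorial / bpP lam (n+1) /
    ((n:ℝ) ^ ((lam+1)/2) * n.factorial / bpP ((lam+1)/2) (n+1)) ^ 2) = _
  have e1 : ((n:ℝ) ^ ((lam+1)/2)) ^ 2 = (n:ℝ) ^ lam * n := by
    rw [← Real.rpow_natCast, ← Real.rpow_mul hn'.le, ← Real.rpow_add_one hn'.ne']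
    congr 1; push_cast; ring
  rw [div_pow, mul_pow, e1, Nat.factorial_succ]
  have : (n.factorial : ℝ) ≠ 0 := by exact_mod_cast n.factorial_ne_zero
  have : (n:ℝ) ^ lam ≠ 0 := by positivity
  push_cast
  field_simp

lemma bp_abel_le {b : ℕ → ℝ} {L x s : ℝ} (hm : Monotone b) (ht : Filter.Tendsto b Filter.atTop (nhds L))
    (hx0 : 0 ≤ x) (hx1 : x < 1) (hs : HasSum (fun n => b n * x ^ n) s) : (1 - x) * s ≤ L := by
  have h1 := (hasSum_geometric_of_lt_one hx0 hx1).mul_left L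
  have h2 := hasSum_le (fun n => mul_le_mul_of_nonneg_right (hm.ge_of_tendsto ht n) (pow_nonneg hx0 n)) hs h1
  have : 0 < 1 - x := by linarith
  calc (1 - x) * s ≤ (1 - x) * (L * (1 - x)⁻¹) := by gcongr
    _ = L := by field_simp

lemma bp_abel_ge {b : ℕ → ℝ} {x s : ℝ} (hm : Monotone b) (hb : ∀ n, 0 ≤ b n) (N : ℕ)
    (hx0 : 0 ≤ x) (hx1 : x < 1) (hs : HasSum (fun n => b n * x ^ n) s) : b N * x ^ N ≤ (1 - x) * s := by
  have h1 := ((hasSum_geometric_of_lt_one hx0 hx1).mul_left (b N * x ^ N))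
  have h2 : ∑ n ∈ Finset.range N, b n * x ^ n + ∑' n, b (n + N) * x ^ (n + N) = s := by
    rw [← hs.tsum_eq]; exact hs.summable.sum_add_tsum_nat_add N
  have h3 : HasSum (fun n => b (n + N) * x ^ (n + N)) (∑' n, b (n + N) * x ^ (n + N)) :=
    ((summable_nat_add_iff N).2 hs.summable).hasSum
  have h4 := hasSum_le (fun n => by
    have : b N ≤ b (n + N) := hm (by omega)
    calc b N * x ^ N * x ^ n = b N * x ^ (n + N) := by rw [pow_add]; ring
      _ ≤ b (n + N) * x ^ (n + N) := by gcongr) h1 h3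
  have h5 : 0 ≤ ∑ n ∈ Finset.range N, b n * x ^ n :=
    Finset.sum_nonneg fun n _ => mul_nonneg (hb n) (pow_nonneg hx0 n)
  have : 0 < 1 - x := by linarith
  calc b N * x ^ N = (1 - x) * (b N * x ^ N * (1 - x)⁻¹) := by field_simp
    _ ≤ (1 - x) * s := by gcongr; linarith

lemma bp_norm_inner_lt {d : ℕ} {z w : Cd d} (hw : ‖w‖ < 1) :
    ‖(inner ℂ w z : ℂ)‖ ≤ ‖z‖ :=
  (norm_inner_le_norm _ _).trans (mul_le_of_le_one_left (norm_nonneg _) hw.le)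

lemma bp_series (d : ℕ) (hd : 0 < d) (σ : ℝ) (hσ : -1 < σ) (z : Cd d) (hz : ‖z‖ < 1) :
    HasSum (fun n => bpB (d + 1 + σ) n * (‖z‖ ^ 2) ^ n)
      (cCoef d σ * ∫ w, ‖1 - (inner ℂ w z : ℂ)‖ ^ (-(d + 1 + σ + 1)) ∂(bpNu d σ)) := by
  have := bp_finite d hd σ hσ
  set lam : ℝ := d + 1 + σ with hlam
  have hd1 : (1:ℝ) ≤ d := by exact_mod_cast hd
  have hl : 1 < lam := by linarith
  set a := (lam + 1) / 2 with ha
  have ha0 : 0 < a := by linarith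
  set q : ℕ → ℝ := fun n => bpP a n / n.factorial with hq
  have hq0 : ∀ n, 0 ≤ q n := fun n => div_nonneg (bpP_pos ha0 n).le (by positivity)
  have hsum := bp_binom_summable ha0 ‖z‖ (norm_nonneg _) hz
  let F : ℕ × ℕ → Cd d → ℂ := fun p w =>
    ((q p.1 : ℂ) * (inner ℂ w z) ^ p.1) * ((q p.2 : ℂ) * (starRingEnd ℂ) (inner ℂ w z) ^ p.2)
  have hcont : ∀ p, Continuous (F p) := by
    intro p
    have h1 : Continuous fun w : Cd d => (inner ℂ w z : ℂ) := by fun_prop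
    have h2 : Continuous fun w : Cd d => (starRingEnd ℂ) (inner ℂ w z : ℂ) :=
      Complex.continuous_conj.comp h1
    fun_prop
  have hFb : ∀ p, ∀ᵐ w ∂(bpNu d σ), ‖F p w‖ ≤ (q p.1 * ‖z‖ ^ p.1) * (q p.2 * ‖z‖ ^ p.2) := by
    intro p
    filter_upwards [bp_nu_ball d σ] with w hw
    have hi := bp_norm_inner_lt (z := z) hw
    simp only [F, norm_mul, norm_pow, Complex.norm_real, RCLike.norm_conj,
      Real.norm_of_nonneg (hq0 _)]
    have := hq0 p.1
    have := hq0 p.2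
    gcongr
  have hFint : ∀ p, Integrable (F p) (bpNu d σ) := fun p =>
    Integrable.of_bound (hcont p).aestronglyMeasurable _ (hFb p)
  have hFsum : Summable fun p => ∫ w, ‖F p w‖ ∂(bpNu d σ) := by
    have h1 : Summable fun p : ℕ × ℕ => (q p.1 * ‖z‖ ^ p.1) * (q p.2 * ‖z‖ ^ p.2) :=
      hsum.mul_of_nonneg hsum (fun n => mul_nonneg (hq0 n) (by positivity))
        (fun n => mul_nonneg (hq0 n) (by positivity))
    refine Summable.of_nonneg_of_le (fun p => integral_nonneg fun _ => norm_nonneg _) (fun p => ?_)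
      (h1.mul_right ((bpNu d σ).real Set.univ))
    calc ∫ w, ‖F p w‖ ∂(bpNu d σ) ≤ ∫ w, (q p.1 * ‖z‖ ^ p.1) * (q p.2 * ‖z‖ ^ p.2) ∂(bpNu d σ) :=
          integral_mono_ae (hFint p).norm (integrable_const _) (hFb p)
      _ = _ := by simp [mul_comm]
  have key := hasSum_integral_of_summable_integral_norm hFint hFsum
  have htot : ∫ w, ∑' p, F p w ∂(bpNu d σ) =
      ((∫ w, ‖1 - (inner ℂ w z : ℂ)‖ ^ (-(lam + 1)) ∂(bpNu d σ) : ℝ) : ℂ) := by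
    rw [← integral_complex_ofReal]
    refine integral_congr_ae ?_
    filter_upwards [bp_nu_ball d σ] with w hw
    have hi := bp_norm_inner_lt (z := z) hw
    have hi1 := hi.trans_lt hz
    have s3 := bp_pointwise a q hq (inner ℂ w z) hi1
    have e : -(lam + 1) = -(2 * a) := by rw [ha]; ring
    rw [e]
    exact s3.tsum_eq
  rw [htot] at key
  have hinj : Function.Injective (fun n : ℕ => (n, n)) := fun m n h => (Prod.mk.inj h).1
  rw [← hinj.hasSum_iff (fun p hp => ?_)] at key
  swap
  · have hne : p.1 ≠ p.2 := fun h => hp ⟨p.1, by ext <;> simp [h]⟩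
    have := bp_orth d σ z p.1 p.2 hne
    calc ∫ w, F p w ∂(bpNu d σ) = ∫ w, ((q p.1 : ℂ) * q p.2) *
        ((inner ℂ w z) ^ p.1 * (starRingEnd ℂ) (inner ℂ w z) ^ p.2) ∂(bpNu d σ) := by
          congr 1; ext w; simp only [F]; ring
      _ = 0 := by rw [integral_const_mul, this, mul_zero]
  have hdiag : ((fun p => ∫ w, F p w ∂(bpNu d σ)) ∘ fun n : ℕ => (n, n)) =
      fun n => ((q n ^ 2 * ∫ w, ‖(inner ℂ w z : ℂ)‖ ^ (2 * n) ∂(bpNu d σ) : ℝ) : ℂ) := by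
    ext n
    rw [← integral_const_mul, ← integral_complex_ofReal]
    simp only [Function.comp]
    congr 1
    ext w
    simp only [F]
    have := Complex.mul_conj (inner ℂ w z : ℂ)
    rw [Complex.normSq_eq_norm_sq] at this
    calc _ = (q n : ℂ) ^ 2 * ((inner ℂ w z) * (starRingEnd ℂ) (inner ℂ w z)) ^ n := by
          rw [mul_pow]; ring
      _ = _ := by rw [this]; push_cast; rw [pow_mul]
  rw [hdiag, Complex.hasSum_ofReal] at key
  have key2 := key.mul_left (cCoef d σ)
  have hfun : (fun n => cCoef d σ * (q n ^ 2 * ∫ w, ‖(inner ℂ w z : ℂ)‖ ^ (2 * n) ∂(bpNu d σ))) =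
      fun n => bpB lam n * (‖z‖ ^ 2) ^ n := by
    ext n
    rw [mul_left_comm, bp_moment d hd n z σ hσ, ← hlam, bpP_gamma (by linarith) n]
    have p1 := bpP_pos (s := lam) (by linarith) n
    have p2 : Real.Gamma lam ≠ 0 := (Real.Gamma_pos_of_pos (by linarith)).ne'
    have : (n.factorial : ℝ) ≠ 0 := by exact_mod_cast n.factorial_ne_zero
    simp only [bpB, q, ← ha, pow_mul]
    field_simp
  rw [← hfun]
  exact key2


lemma bp_bergman_eq (d : ℕ) (σ : ℝ) (G : Cd d → ℂ) (z : Cd d) :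
    bergman d σ G z = (cCoef d σ : ℂ) *
      ∫ w, G w * (1 - innerSL ℂ w z) ^ (-((d + 1 + σ : ℝ) : ℂ)) ∂(bpNu d σ) := by
  rw [bergman, bp_nu_integral]
  congr 2
  ext w
  rw [bergKer, bp_herm_inner, Complex.cpow_neg, innerSL_apply_apply, Complex.real_smul]
  ring

lemma bp_one_sub {R : ℝ} {u : ℂ} (hu : ‖u‖ ≤ R) : 1 - R ≤ ‖1 - u‖ := by
  have := norm_sub_norm_le (1:ℂ) u
  rw [norm_one] at this
  linarith

lemma bp_rpow_bound {R p : ℝ} {u : ℂ} (hp : 0 ≤ p) (hR : R < 1) (hu : ‖u‖ ≤ R) :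
    ‖1 - u‖ ^ (-p) ≤ (1 - R) ^ (-p) :=
  Real.rpow_le_rpow_of_nonpos (by linarith) (bp_one_sub hu) (by linarith)

lemma bp_int (d : ℕ) (hd : 0 < d) (σ : ℝ) (hσ : -1 < σ) (z : Cd d) (hz : ‖z‖ < 1) (p : ℝ) (hp : 0 ≤ p) :
    Integrable (fun w => ‖1 - (inner ℂ w z : ℂ)‖ ^ (-p)) (bpNu d σ) := by
  have := bp_finite d hd σ hσ
  refine Integrable.of_bound (C := (1 - ‖z‖) ^ (-p)) ?_ ?_
  · have h1 : Continuous fun w : Cd d => ‖1 - (inner ℂ w z : ℂ)‖ := by fun_prop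
    exact (h1.measurable.pow_const _).aestronglyMeasurable
  · filter_upwards [bp_nu_ball d σ] with w hw
    rw [Real.norm_of_nonneg (by positivity)]
    exact bp_rpow_bound hp hz (bp_norm_inner_lt hw)

noncomputable def bpF (d : ℕ) (lam : ℝ) (G : Cd d → ℂ) (z w : Cd d) : Cd d →L[ℂ] ℂ :=
  (G w * (lam * (1 - innerSL ℂ w z) ^ (-(lam : ℂ) - 1))) • innerSL ℂ w

lemma bpF_norm (d : ℕ) (lam : ℝ) (hl : 0 ≤ lam) (G : Cd d → ℂ) (hG : ∀ w, ‖G w‖ ≤ 1) (z w : Cd d)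
    (hw : ‖w‖ < 1) : ‖bpF d lam G z w‖ ≤ lam * ‖1 - (inner ℂ w z : ℂ)‖ ^ (-(lam + 1)) := by
  have e : (-(lam : ℂ) - 1) = ((-(lam + 1) : ℝ) : ℂ) := by push_cast; ring
  rw [bpF, norm_smul, innerSL_apply_norm, norm_mul, norm_mul, e, Complex.norm_cpow_real,
    Complex.norm_real, Real.norm_of_nonneg hl, innerSL_apply_apply]
  have h1 : 0 ≤ lam * ‖1 - (inner ℂ w z : ℂ)‖ ^ (-(lam + 1)) := by positivity
  calc _ ≤ (1 * (lam * ‖1 - (inner ℂ w z : ℂ)‖ ^ (-(lam + 1)))) * 1 := by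
        gcongr
        exact hG w
    _ = _ := by ring

lemma bpF_meas (d : ℕ) (σ : ℝ) (lam : ℝ) (G : Cd d → ℂ) (hG : Measurable G) (z : Cd d) :
    AEStronglyMeasurable (bpF d lam G z) (bpNu d σ) := by
  have h1 : Continuous fun w : Cd d => (1 - innerSL ℂ w z : ℂ) := by
    simp only [innerSL_apply_apply]; fun_prop
  have h2 : Measurable fun w : Cd d => G w * (lam * (1 - innerSL ℂ w z) ^ (-(lam : ℂ) - 1)) :=
    hG.mul ((h1.measurable.pow_const _).const_mul _)
  have h3 : Continuous fun w : Cd d => innerSL ℂ w := (innerSL ℂ).continuous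
  exact h2.aestronglyMeasurable.smul h3.aestronglyMeasurable

lemma bp_deriv (d : ℕ) (hd : 0 < d) (σ : ℝ) (hσ : -1 < σ) (G : Cd d → ℂ) (hGm : Measurable G)
    (hG : ∀ w, ‖G w‖ ≤ 1) (z : Cd d) (hz : ‖z‖ < 1) :
    Integrable (bpF d (d + 1 + σ) G z) (bpNu d σ) ∧
    HasFDerivAt (bergman d σ G) ((cCoef d σ : ℂ) • ∫ w, bpF d (d + 1 + σ) G z w ∂(bpNu d σ)) z := by
  have := bp_finite d hd σ hσ
  set lam : ℝ := d + 1 + σ with hlam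
  have hl : 0 ≤ lam := by have : (0:ℝ) ≤ d := by positivity
                          linarith
  have hint : Integrable (bpF d lam G z) (bpNu d σ) := by
    refine ((bp_int d hd σ hσ z hz (lam + 1) (by linarith)).const_mul lam).mono' (bpF_meas d σ lam G hGm z) ?_
    filter_upwards [bp_nu_ball d σ] with w hw
    exact bpF_norm d lam hl G hG z w hw
  refine ⟨hint, ?_⟩
  have hfun : bergman d σ G = fun z => (cCoef d σ : ℂ) *
      ∫ w, G w * (1 - innerSL ℂ w z) ^ (-(lam : ℂ)) ∂(bpNu d σ) := by
    ext z; exact bp_bergman_eq d σ G z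
  rw [hfun]
  apply HasFDerivAt.const_mul
  set R := (1 + ‖z‖) / 2 with hR
  have hR1 : R < 1 := by linarith
  have hzR : ‖z‖ < R := by linarith
  have hmeas : ∀ x : Cd d, AEStronglyMeasurable
      (fun w => G w * (1 - innerSL ℂ w x) ^ (-(lam : ℂ))) (bpNu d σ) := by
    intro x
    have h1 : Continuous fun w : Cd d => (1 - innerSL ℂ w x : ℂ) := by
      simp only [innerSL_apply_apply]; fun_prop
    exact (hGm.mul (h1.measurable.pow_const _)).aestronglyMeasurable
  refine hasFDerivAt_integral_of_dominated_of_fderiv_le (s := ball 0 R)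
    (bound := fun _ => lam * (1 - R) ^ (-(lam + 1)))
    (isOpen_ball.mem_nhds (by simpa using hzR)) (.of_forall hmeas) ?_ (bpF_meas d σ lam G hGm z) ?_
    (integrable_const _) ?_
  · refine (bp_int d hd σ hσ z hz lam hl).mono' (hmeas z) ?_
    refine .of_forall fun w => ?_
    have e : (-(lam : ℂ)) = ((-lam : ℝ) : ℂ) := by push_cast; ring
    rw [norm_mul, e, Complex.norm_cpow_real, innerSL_apply_apply]
    exact mul_le_of_le_one_left (by positivity) (hG w)
  · filter_upwards [bp_nu_ball d σ] with w hw x hx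
    have hx : ‖x‖ < R := by simpa using hx
    refine (bpF_norm d lam hl G hG x w hw).trans ?_
    have hb : ‖1 - (inner ℂ w x : ℂ)‖ ^ (-(lam + 1)) ≤ (1 - R) ^ (-(lam + 1)) :=
      bp_rpow_bound (p := lam + 1) (by linarith) hR1 ((bp_norm_inner_lt hw).trans hx.le)
    exact mul_le_mul_of_nonneg_left hb hl
  · filter_upwards [bp_nu_ball d σ] with w hw x hx
    have hx : ‖x‖ < R := by simpa using hx
    have hu : ‖innerSL ℂ w x‖ < 1 := by
      rw [innerSL_apply_apply]
      exact (bp_norm_inner_lt hw).trans_lt (hx.trans hR1)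
    have hsl : 1 - innerSL ℂ w x ∈ Complex.slitPlane := by
      left
      have := (Complex.re_le_norm (innerSL ℂ w x)).trans_lt hu
      simp only [Complex.sub_re, Complex.one_re]
      linarith
    have h1 : HasDerivAt (fun t : ℂ => (1 - t) ^ (-(lam:ℂ)))
        (-(lam:ℂ) * (1 - innerSL ℂ w x) ^ (-(lam:ℂ) - 1) * (-1)) (innerSL ℂ w x) :=
      ((hasDerivAt_id _).const_sub 1).cpow_const hsl
    have h2 := (h1.comp_hasFDerivAt x (innerSL ℂ w).hasFDerivAt).const_mul (G w)
    refine h2.congr_fderiv ?_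
    rw [bpF, smul_smul]
    congr 1
    ring

lemma bp_sqrt_le (d : ℕ) (L : Cd d →L[ℂ] ℂ) :
    Real.sqrt (∑ j, ‖L (EuclideanSpace.single j 1)‖ ^ 2) ≤ ‖L‖ := by
  set S := ∑ j, ‖L (EuclideanSpace.single j 1)‖ ^ 2 with hS
  have hS0 : 0 ≤ S := Finset.sum_nonneg fun _ _ => by positivity
  let v : Cd d := WithLp.toLp 2 fun j => (starRingEnd ℂ) (L (EuclideanSpace.single j 1))
  have hv : ‖v‖ = Real.sqrt S := by
    rw [EuclideanSpace.norm_eq]; simp [v, hS]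
  have hLv : L v = (S : ℂ) := by
    have h1 : v = ∑ j, v j • EuclideanSpace.single j (1:ℂ) := by
      ext k; simp [Finset.sum_apply, Pi.single_apply]
    rw [h1, map_sum, hS]
    push_cast
    refine Finset.sum_congr rfl fun j _ => ?_
    rw [map_smul, smul_eq_mul, ← Complex.ofReal_pow, ← Complex.normSq_eq_norm_sq, ← Complex.mul_conj, mul_comm]
  have h2 := L.le_opNorm v
  rw [hLv, hv, Complex.norm_real, Real.norm_of_nonneg hS0] at h2
  by_cases h0 : Real.sqrt S = 0
  · rw [h0]; exact norm_nonneg _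
  · have hp : 0 < Real.sqrt S := lt_of_le_of_ne (Real.sqrt_nonneg _) (Ne.symm h0)
    rw [← Real.mul_self_sqrt hS0] at h2
    simp only [Real.sqrt_mul_self hp.le] at h2
    exact le_of_mul_le_mul_right h2 hp

lemma bp_upper (d : ℕ) (hd : 0 < d) (σ : ℝ) (hσ : -1 < σ) (G : Cd d → ℂ) (hGm : Measurable G)
    (hG : ∀ w, ‖G w‖ ≤ 1) (z : Cd d) (hz : ‖z‖ < 1) :
    (1 - ‖z‖ ^ 2) * Real.sqrt (∑ j, ‖pd d j (bergman d σ G) z‖ ^ 2) ≤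
      (d + 1 + σ) * (Real.Gamma (d + 1 + σ) / Real.Gamma ((d + 1 + σ + 1) / 2) ^ 2) := by
  obtain ⟨hint, hder⟩ := bp_deriv d hd σ hσ G hGm hG z hz
  have hd1 : (1:ℝ) ≤ d := by exact_mod_cast hd
  have hser := bp_series d hd σ hσ z hz
  set lam : ℝ := d + 1 + σ with hlam
  have hl : 1 < lam := by linarith
  have hz2 : ‖z‖ ^ 2 < 1 := by nlinarith [norm_nonneg z]
  have hA := bp_abel_le (bpB_mono hl) (bpB_tendsto hl) (by positivity) hz2 hser
  have hc := bp_c_pos d σ hσ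
  have h1 : Real.sqrt (∑ j, ‖pd d j (bergman d σ G) z‖ ^ 2) ≤
      lam * (cCoef d σ * ∫ w, ‖1 - (inner ℂ w z : ℂ)‖ ^ (-(lam + 1)) ∂(bpNu d σ)) := by
    simp only [pd, hder.fderiv]
    refine (bp_sqrt_le d _).trans ?_
    rw [norm_smul, Complex.norm_real, Real.norm_of_nonneg hc.le, mul_left_comm, ← integral_const_mul]
    gcongr
    refine norm_integral_le_of_norm_le ((bp_int d hd σ hσ z hz (lam + 1) (by linarith)).const_mul lam) ?_
    filter_upwards [bp_nu_ball d σ] with w hw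
    exact bpF_norm d lam (by linarith) G hG z w hw
  calc _ ≤ (1 - ‖z‖ ^ 2) * (lam * (cCoef d σ * ∫ w, ‖1 - (inner ℂ w z : ℂ)‖ ^ (-(lam + 1)) ∂(bpNu d σ))) := by
        apply mul_le_mul_of_nonneg_left h1; linarith
    _ = lam * ((1 - ‖z‖ ^ 2) * (cCoef d σ * ∫ w, ‖1 - (inner ℂ w z : ℂ)‖ ^ (-(lam + 1)) ∂(bpNu d σ))) := by ring
    _ ≤ _ := by apply mul_le_mul_of_nonneg_left hA; linarith

/-- test function -/
noncomputable def bpG (d : ℕ) (lam : ℝ) (z w : Cd d) : ℂ :=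
  (1 - innerSL ℂ w z) ^ ((lam : ℂ) + 1) / ((‖1 - (inner ℂ w z : ℂ)‖ ^ (lam + 1) : ℝ) : ℂ)

lemma bpG_norm (d : ℕ) (lam : ℝ) (z w : Cd d) : ‖bpG d lam z w‖ ≤ 1 := by
  have e : ((lam : ℂ) + 1) = ((lam + 1 : ℝ) : ℂ) := by push_cast; ring
  rw [bpG, e, norm_div, Complex.norm_cpow_real, innerSL_apply_apply, Complex.norm_real, Real.norm_of_nonneg (by positivity)]
  exact div_self_le_one _

lemma bpG_meas (d : ℕ) (lam : ℝ) (z : Cd d) : Measurable (bpG d lam z) := by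
  have h1 : Continuous fun w : Cd d => (1 - innerSL ℂ w z : ℂ) := by
    simp only [innerSL_apply_apply]; fun_prop
  have h2 : Continuous fun w : Cd d => ‖1 - (inner ℂ w z : ℂ)‖ := by fun_prop
  exact (h1.measurable.pow_const _).div (Complex.measurable_ofReal.comp (h2.measurable.pow_const _))

lemma bp_lower (d : ℕ) (i : Fin d) (σ : ℝ) (hσ : -1 < σ) (r : ℝ) (hr0 : 0 ≤ r) (hr : r < 1)
    (N : ℕ) (ε : ℝ) (hε : 0 < ε) :
    (d + 1 + σ) * (bpB (d + 1 + σ) N * (r ^ 2) ^ N - 2 * (ε *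
        (Real.Gamma (d + 1 + σ) / Real.Gamma ((d + 1 + σ + 1) / 2) ^ 2)
        + (1 - r ^ 2) * ε⁻¹ ^ (d + 1 + σ))) ≤
    (1 - ‖EuclideanSpace.single i (r:ℂ)‖ ^ 2) * Real.sqrt (∑ j, ‖pd d j (bergman d σ
      (bpG d (d + 1 + σ) (EuclideanSpace.single i (r:ℂ)))) (EuclideanSpace.single i (r:ℂ))‖ ^ 2) := by
  have hd : 0 < d := i.pos
  have := bp_finite d hd σ hσ
  set z : Cd d := EuclideanSpace.single i (r:ℂ) with hzdef
  have hzn : ‖z‖ = r := by simp [hzdef, abs_of_nonneg hr0]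
  have hz : ‖z‖ < 1 := by rw [hzn]; exact hr
  obtain ⟨hint, hder⟩ := bp_deriv d hd σ hσ _ (bpG_meas d (d + 1 + σ) z) (bpG_norm d (d + 1 + σ) z) z hz
  have hd1 : (1:ℝ) ≤ d := by exact_mod_cast hd
  have hser := bp_series d hd σ hσ z hz
  have hmass := bp_mass d hd σ hσ
  set lam : ℝ := d + 1 + σ with hlam
  set LL := Real.Gamma lam / Real.Gamma ((lam + 1) / 2) ^ 2 with hLL
  have hl : 1 < lam := by linarith
  have hr2 : r ^ 2 < 1 := by nlinarith
  rw [hzn] at hser ⊢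
  have hA := bp_abel_le (bpB_mono hl) (bpB_tendsto hl) (by positivity) hr2 hser
  have hB := bp_abel_ge (bpB_mono hl) (fun n => (bpB_pos hl n).le) N (by positivity) hr2 hser
  have hc := bp_c_pos d σ hσ
  set J := ∫ w, ‖1 - (inner ℂ w z : ℂ)‖ ^ (-(lam + 1)) ∂(bpNu d σ) with hJ
  have hJi := bp_int d hd σ hσ z hz (lam + 1) (by linarith)
  set L := (cCoef d σ : ℂ) • ∫ w, bpF d lam (bpG d lam z) z w ∂(bpNu d σ) with hL
  -- pointwise formula
  have hin : ∀ w : Cd d, (inner ℂ w z : ℂ) = r * (starRingEnd ℂ) (w i) := by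
    intro w; simp [hzdef, PiLp.inner_apply, EuclideanSpace.inner_single_right]
  have hpt : ∀ w : Cd d, ‖w‖ < 1 → (bpF d lam (bpG d lam z) z w (EuclideanSpace.single i 1)).re =
      lam * ((w i).re * ‖1 - (inner ℂ w z : ℂ)‖ ^ (-(lam + 1))) := by
    intro w hw
    have hu : ‖(inner ℂ w z : ℂ)‖ < 1 := (bp_norm_inner_lt hw).trans_lt hz
    have hne : (1 - (inner ℂ w z : ℂ)) ≠ 0 := by
      intro h0
      have := bp_one_sub hu.le
      have h3 := bp_one_sub (le_refl ‖(inner ℂ w z : ℂ)‖)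
      rw [h0, norm_zero] at h3
      linarith
    have e1 : (innerSL ℂ w) (EuclideanSpace.single i 1) = (starRingEnd ℂ) (w i) := by
      simp [EuclideanSpace.inner_single_right]
    have e2 : bpG d lam z w * (lam * (1 - innerSL ℂ w z) ^ (-(lam : ℂ) - 1)) =
        ((lam * ‖1 - (inner ℂ w z : ℂ)‖ ^ (-(lam + 1)) : ℝ) : ℂ) := by
      rw [bpG, innerSL_apply_apply, Real.rpow_neg (norm_nonneg _)]
      have e3 : (-(lam : ℂ) - 1) = -((lam:ℂ) + 1) := by ring
      have h4 : (1 - (inner ℂ w z : ℂ)) ^ ((lam:ℂ) + 1) ≠ 0 := by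
        simp [Complex.cpow_eq_zero_iff, hne]
      rw [e3, Complex.cpow_neg]
      push_cast
      field_simp
    rw [bpF, _root_.smul_apply, e1, e2, smul_eq_mul, Complex.re_ofReal_mul, Complex.conj_re]
    ring
  have hre : (L (EuclideanSpace.single i 1)).re = cCoef d σ * (lam *
      ∫ w, (w i).re * ‖1 - (inner ℂ w z : ℂ)‖ ^ (-(lam + 1)) ∂(bpNu d σ)) := by
    rw [hL, _root_.smul_apply, ContinuousLinearMap.integral_apply hint, smul_eq_mul,
      Complex.re_ofReal_mul, ← integral_const_mul]
    congr 1
    have hi2 : Integrable (fun w => bpF d lam (bpG d lam z) z w (EuclideanSpace.single i 1)) (bpNu d σ) :=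
      hint.apply_continuousLinearMap _
    rw [← RCLike.re_eq_complex_re, ← integral_re hi2]
    refine integral_congr_ae ?_
    filter_upwards [bp_nu_ball d σ] with w hw
    exact hpt w hw
  -- lower bound for the integrand
  have hlow : J - 2 * (ε * J + ε⁻¹ ^ lam * ∫ _w, (1:ℝ) ∂(bpNu d σ)) ≤
      ∫ w, (w i).re * ‖1 - (inner ℂ w z : ℂ)‖ ^ (-(lam + 1)) ∂(bpNu d σ) := by
    have e : J - 2 * (ε * J + ε⁻¹ ^ lam * ∫ _w, (1:ℝ) ∂(bpNu d σ)) =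
        ∫ w, (‖1 - (inner ℂ w z : ℂ)‖ ^ (-(lam + 1)) -
          2 * (ε * ‖1 - (inner ℂ w z : ℂ)‖ ^ (-(lam + 1)) + ε⁻¹ ^ lam * 1)) ∂(bpNu d σ) := by
      have i1 := hJi.const_mul ε
      have i2 : Integrable (fun _ : Cd d => ε⁻¹ ^ lam * (1:ℝ)) (bpNu d σ) := integrable_const _
      have i3 : Integrable (fun w : Cd d => ε * ‖1 - (inner ℂ w z : ℂ)‖ ^ (-(lam + 1)) +
          ε⁻¹ ^ lam * (1:ℝ)) (bpNu d σ) := i1.add i2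
      have i4 : Integrable (fun w : Cd d => 2 * (ε * ‖1 - (inner ℂ w z : ℂ)‖ ^ (-(lam + 1)) +
          ε⁻¹ ^ lam * (1:ℝ))) (bpNu d σ) := i3.const_mul 2
      rw [integral_sub hJi i4, integral_const_mul, integral_add i1 i2,
        integral_const_mul, integral_const_mul]
    rw [e]
    refine integral_mono_ae ?_ ?_ ?_
    · exact hJi.sub (((hJi.const_mul ε).add (integrable_const _)).const_mul 2)
    · refine hJi.mono' ?_ ?_
      · have h1 : Continuous fun w : Cd d => ‖1 - (inner ℂ w z : ℂ)‖ := by fun_prop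
        have h2 : Continuous fun w : Cd d => (w i).re := by fun_prop
        exact (h2.measurable.mul (h1.measurable.pow_const _)).aestronglyMeasurable
      · filter_upwards [bp_nu_ball d σ] with w hw
        rw [norm_mul, Real.norm_of_nonneg (by positivity : (0:ℝ) ≤ ‖1 - (inner ℂ w z : ℂ)‖ ^ (-(lam + 1)))]
        apply mul_le_of_le_one_left (by positivity)
        exact (Complex.abs_re_le_norm _).trans ((PiLp.norm_apply_le w i).trans hw.le)
    · filter_upwards [bp_nu_ball d σ] with w hw
      have hx1 : |(w i).re| ≤ 1 := (Complex.abs_re_le_norm _).trans ((PiLp.norm_apply_le w i).trans hw.le)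
      have hu : ‖(inner ℂ w z : ℂ)‖ ≤ r := hzn ▸ bp_norm_inner_lt hw
      set x := (w i).re
      set t := ‖1 - (inner ℂ w z : ℂ)‖ with ht
      have ht0 : 0 < t := by have := bp_one_sub hu; linarith
      have hre : 1 - r * x ≤ t := by
        have := Complex.re_le_norm (1 - (inner ℂ w z : ℂ))
        rw [hin] at this
        simpa [ht, hin, x] using this
      rw [abs_le] at hx1
      have hx2 : 1 - x ≤ 2 * t := by nlinarith
      have hs : t ^ (-lam) = t * t ^ (-(lam+1)) := by
        rw [← Real.rpow_one_add' ht0.le (by linarith)]; congr 1; ring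
      have hp : t ^ (-lam) ≤ ε * t ^ (-(lam + 1)) + ε⁻¹ ^ lam * 1 := by
        by_cases hte : t ≤ ε
        · rw [hs]
          have : t * t ^ (-(lam+1)) ≤ ε * t ^ (-(lam+1)) := by gcongr
          have : 0 ≤ ε⁻¹ ^ lam * 1 := by positivity
          linarith
        · push Not at hte
          have h1 : t ^ (-lam) ≤ ε ^ (-lam) :=
            Real.rpow_le_rpow_of_nonpos hε hte.le (by linarith)
          rw [Real.rpow_neg hε.le, ← Real.inv_rpow hε.le] at h1
          have : 0 ≤ ε * t ^ (-(lam+1)) := by positivity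
          linarith
      have hq : 0 ≤ t ^ (-(lam+1)) := by positivity
      have h5 : (1 - x) * t ^ (-(lam+1)) ≤ 2 * t * t ^ (-(lam+1)) := by gcongr
      rw [hs] at hp
      have h6 : 2 * t * t ^ (-(lam+1)) = 2 * (t * t ^ (-(lam+1))) := by ring
      linarith
  have hpd : (L (EuclideanSpace.single i 1)).re ≤
      Real.sqrt (∑ j, ‖pd d j (bergman d σ (bpG d lam z)) z‖ ^ 2) := by
    simp only [pd, hder.fderiv]
    refine (Complex.re_le_norm _).trans ?_
    apply Real.le_sqrt_of_sq_le
    exact Finset.single_le_sum (f := fun j => ‖L (EuclideanSpace.single j 1)‖ ^ 2)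
      (fun j _ => by positivity) (Finset.mem_univ i)
  have hlp : 0 < lam := by linarith
  set M := ∫ _w : Cd d, (1:ℝ) ∂(bpNu d σ) with hM
  have h1r : 0 < 1 - r ^ 2 := by linarith
  have hcl : cCoef d σ * (lam * (J - 2 * (ε * J + ε⁻¹ ^ lam * M))) ≤
      (L (EuclideanSpace.single i 1)).re := by rw [hre]; gcongr
  calc _ ≤ lam * ((1 - r^2) * (cCoef d σ * J) - 2 * (ε * ((1 - r^2) * (cCoef d σ * J)) +
          (1 - r^2) * ε⁻¹ ^ lam)) := by
        gcongr
    _ = (1 - r^2) * (cCoef d σ * (lam * (J - 2 * (ε * J + ε⁻¹ ^ lam * M)))) := by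
        linear_combination (2 * lam * (1 - r^2) * ε⁻¹ ^ lam) * hmass
    _ ≤ _ := by
        apply mul_le_mul_of_nonneg_left (hcl.trans hpd) h1r.le


/-- With the Bloch seminorm `‖f‖_𝓑 = sup_{z∈B} (1-|z|²)|∇f(z)|` (Euclidean norm of the
complex gradient), `‖T_σ‖_{L^∞(B)→𝓑} = Γ(λ+1)/Γ((λ+1)/2)²`. -/
theorem bergman_projection_seminorm_gradient
    (d : ℕ) (hd : 0 < d) (σ : ℝ) (hσ : -1 < σ) (lam : ℝ) (hlam : lam = d + 1 + σ) :
    (⨆ G : {G : Cd d → ℂ // Measurable G ∧ ∀ w, ‖G w‖ ≤ 1},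
        ⨆ z : unitBall d,
          (1 - ‖(z : Cd d)‖ ^ 2) *
            Real.sqrt (∑ j, ‖pd d j (bergman d σ G.1) (z : Cd d)‖ ^ 2)) =
      Real.Gamma (lam + 1) / Real.Gamma ((lam + 1) / 2) ^ 2 := by
  have hd1 : (1:ℝ) ≤ d := by exact_mod_cast hd
  have hl1 : 1 < lam := by rw [hlam]; linarith
  set L := Real.Gamma lam / Real.Gamma ((lam + 1) / 2) ^ 2 with hL
  have hC : Real.Gamma (lam + 1) / Real.Gamma ((lam + 1) / 2) ^ 2 = lam * L := by
    rw [Real.Gamma_add_one (by linarith), hL, mul_div_assoc]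
  rw [hC]
  have hup : ∀ (G : {G : Cd d → ℂ // Measurable G ∧ ∀ w, ‖G w‖ ≤ 1}) (z : unitBall d),
      (1 - ‖(z : Cd d)‖ ^ 2) *
            Real.sqrt (∑ j, ‖pd d j (bergman d σ G.1) (z : Cd d)‖ ^ 2) ≤ lam * L := by
    intro G z
    have hz : ‖(z : Cd d)‖ < 1 := by
      have := z.2
      simpa [unitBall] using this
    have h := bp_upper d hd σ hσ G.1 G.2.1 G.2.2 z hz
    rw [← hlam] at h
    exact h
  haveI : Nonempty (unitBall d) := ⟨⟨0, by simp [unitBall]⟩⟩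
  haveI : Nonempty {G : Cd d → ℂ // Measurable G ∧ ∀ w, ‖G w‖ ≤ 1} :=
    ⟨⟨fun _ => 0, measurable_const, fun _ => by simp⟩⟩
  apply le_antisymm
  · exact ciSup_le fun G => ciSup_le fun z => hup G z
  set S := (⨆ G : {G : Cd d → ℂ // Measurable G ∧ ∀ w, ‖G w‖ ≤ 1},
        ⨆ z : unitBall d,
          (1 - ‖(z : Cd d)‖ ^ 2) *
            Real.sqrt (∑ j, ‖pd d j (bergman d σ G.1) (z : Cd d)‖ ^ 2)) with hS
  have hle : ∀ (G : {G : Cd d → ℂ // Measurable G ∧ ∀ w, ‖G w‖ ≤ 1}) (z : unitBall d),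
      (1 - ‖(z : Cd d)‖ ^ 2) *
            Real.sqrt (∑ j, ‖pd d j (bergman d σ G.1) (z : Cd d)‖ ^ 2) ≤ S := by
    intro G z
    refine le_trans ?_ (le_ciSup (f := fun G : {G : Cd d → ℂ // Measurable G ∧ ∀ w, ‖G w‖ ≤ 1} =>
      ⨆ z : unitBall d, (1 - ‖(z : Cd d)‖ ^ 2) *
            Real.sqrt (∑ j, ‖pd d j (bergman d σ G.1) (z : Cd d)‖ ^ 2)) ?_ G)
    · exact le_ciSup (f := fun z : unitBall d => (1 - ‖(z : Cd d)‖ ^ 2) *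
            Real.sqrt (∑ j, ‖pd d j (bergman d σ G.1) (z : Cd d)‖ ^ 2))
        ⟨lam * L, by rintro _ ⟨z, rfl⟩; exact hup G z⟩ z
    · exact ⟨lam * L, by rintro _ ⟨G, rfl⟩; exact ciSup_le fun z => hup G z⟩
  have hlow : ∀ (N : ℕ) (ε : ℝ), 0 < ε → ∀ r : ℝ, 0 ≤ r → r < 1 →
      lam * (bpB lam N * (r ^ 2) ^ N - 2 * (ε * L + (1 - r ^ 2) * ε⁻¹ ^ lam)) ≤ S := by
    intro N ε hε r hr0 hr
    have h := bp_lower d ⟨0, hd⟩ σ hσ r hr0 hr N ε hε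
    rw [← hlam] at h
    refine h.trans ?_
    have hz : (EuclideanSpace.single (⟨0, hd⟩ : Fin d) (r : ℂ) : Cd d) ∈ unitBall d := by
      simp [unitBall, abs_of_nonneg hr0, hr]
    exact hle ⟨bpG d lam (EuclideanSpace.single (⟨0, hd⟩ : Fin d) (r : ℂ)),
      bpG_meas _ _ _, bpG_norm _ _ _⟩ ⟨_, hz⟩
  have h2 : ∀ (N : ℕ) (ε : ℝ), 0 < ε → lam * (bpB lam N - 2 * (ε * L)) ≤ S := by
    intro N ε hε
    have hc : Continuous fun r : ℝ =>
        lam * (bpB lam N * (r ^ 2) ^ N - 2 * (ε * L + (1 - r ^ 2) * ε⁻¹ ^ lam)) := by fun_prop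
    have ht := (hc.tendsto 1).mono_left (nhdsWithin_le_nhds (s := Set.Iio (1:ℝ)))
    have hb := le_of_tendsto (b := S) ht (by
      filter_upwards [self_mem_nhdsWithin,
        mem_nhdsWithin_of_mem_nhds (Ioi_mem_nhds (zero_lt_one' ℝ))] with r hr hr0
      exact hlow N ε hε r (le_of_lt hr0) hr)
    simpa using hb
  have h3 : ∀ N : ℕ, lam * bpB lam N ≤ S := by
    intro N
    have hc : Continuous fun ε : ℝ => lam * (bpB lam N - 2 * (ε * L)) := by fun_prop
    have ht := (hc.tendsto 0).mono_left (nhdsWithin_le_nhds (s := Set.Ioi (0:ℝ)))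
    have hb := le_of_tendsto (b := S) ht (by
      filter_upwards [self_mem_nhdsWithin] with ε hε
      exact h2 N ε hε)
    simpa using hb
  exact le_of_tendsto' ((bpB_tendsto hl1).const_mul lam) h3
end

section
/- Let σ > -1, λ = d+1+σ, n a positive integer, and equip the Bloch space with the seminorm ‖f‖_𝓑 = sup_{z∈B} (1-|z|²)^n · max_{|α|=n} |∂^α f(z)| (the sup-norm over all multi-indices α of order n). Then the Bergman projection satisfies ‖T_σ‖_{L^∞(B) → 𝓑} = Γ(λ+n)Γ(n) / Γ((λ+n)/2)². -/
open MeasureTheory Complex Metric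
open scoped ENNReal Classical

namespace BergAux

open Filter Topology Set

lemma herm_eq {d : ℕ} (z w : Cd d) : herm z w = inner ℂ w z := by
  simp [herm, PiLp.inner_apply]

lemma herm_smul_right {d : ℕ} (c : ℂ) (z w : Cd d) :
    herm z (c • w) = (starRingEnd ℂ) c * herm z w := by
  rw [herm_eq, herm_eq, inner_smul_left]

lemma herm_smul_left {d : ℕ} (c : ℂ) (z w : Cd d) :
    herm (c • z) w = c * herm z w := by
  rw [herm_eq, herm_eq, inner_smul_right]

lemma norm_herm_le {d : ℕ} (z w : Cd d) : ‖herm z w‖ ≤ ‖z‖ * ‖w‖ := by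
  rw [herm_eq, mul_comm]; exact norm_inner_le_norm _ _

@[fun_prop]
lemma continuous_herm {d : ℕ} (z : Cd d) : Continuous (fun w => herm z w) := by
  simp only [herm_eq]; fun_prop

lemma volume_ball_ne {d : ℕ} : volume (unitBall d) ≠ 0 ∧ volume (unitBall d) ≠ ∞ :=
  ⟨(Metric.measure_ball_pos _ _ one_pos).ne', measure_ball_lt_top.ne⟩

instance (d : ℕ) : (normVol d).IsAddHaarMeasure := by
  unfold normVol
  exact Measure.IsAddHaarMeasure.smul _ (by simpa using volume_ball_ne.2)
    (by simpa using volume_ball_ne.1)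

lemma normVol_ball (d : ℕ) : normVol d (unitBall d) = 1 := by
  simp only [normVol, Measure.smul_apply, smul_eq_mul]
  exact ENNReal.inv_mul_cancel volume_ball_ne.1 volume_ball_ne.2

lemma finrank_Cd (d : ℕ) : Module.finrank ℝ (Cd d) = 2 * d := by
  rw [finrank_real_of_complex]; simp

lemma lintegral_scale {d : ℕ} {r : ℝ} (hr : 0 < r) (f : Cd d → ℝ≥0∞) (hf : Measurable f) :
    ∫⁻ w, f w ∂(normVol d) = ENNReal.ofReal (r ^ (2 * d)) * ∫⁻ w, f (r • w) ∂(normVol d) := by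
  have h := Measure.map_addHaar_smul (normVol d) hr.ne'
  have h2 : ∫⁻ w, f w ∂(Measure.map (r • ·) (normVol d)) = ∫⁻ w, f (r • w) ∂(normVol d) :=
    lintegral_map hf (measurable_const_smul r)
  rw [← h2, h, lintegral_smul_measure, finrank_Cd, smul_eq_mul, ← mul_assoc,
    ← ENNReal.ofReal_mul (by positivity), abs_of_pos (by positivity),
    mul_inv_cancel₀ (by positivity)]
  simp

lemma lintegral_rot {d : ℕ} {c : ℂ} (hc : ‖c‖ = 1) (f : Cd d → ℝ≥0∞) (hf : Measurable f) :
    ∫⁻ w, f (c • w) ∂(normVol d) = ∫⁻ w, f w ∂(normVol d) := by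
  have hc0 : c ≠ 0 := by rintro rfl; simp at hc
  let e : Cd d ≃ₗᵢ[ℝ] Cd d :=
    { (LinearEquiv.smulOfNeZero ℂ (Cd d) c hc0).restrictScalars ℝ with
      norm_map' := fun x => by
        change ‖c • x‖ = ‖x‖
        rw [norm_smul, hc, one_mul] }
  have h := e.measurePreserving.lintegral_comp hf
  have h1 : ∀ w, e w = c • w := fun w => rfl
  simp only [h1] at h
  simp only [normVol, lintegral_smul_measure, h]

end BergAux


namespace BergAux

open Filter Topology Set

/-- The weight `(1-|w|²)^σ` extended by zero outside the ball. -/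
noncomputable def wt {d : ℕ} (σ : ℝ) (w : Cd d) : ℝ≥0∞ :=
  if ‖w‖ < 1 then ENNReal.ofReal ((1 - ‖w‖ ^ 2) ^ σ) else 0

@[fun_prop]
lemma measurable_wt {d : ℕ} (σ : ℝ) : Measurable (wt σ : Cd d → ℝ≥0∞) := by
  unfold wt
  refine Measurable.ite ?_ (by fun_prop) measurable_const
  exact measurableSet_lt (by fun_prop) (by fun_prop)

lemma lintegral_gamma {s : ℝ} (hs : -1 < s) :
    ∫⁻ t in Ioi (0:ℝ), ENNReal.ofReal (Real.exp (-t) * t ^ s) =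
      ENNReal.ofReal (Real.Gamma (s + 1)) := by
  have h0 : 0 < s + 1 := by linarith
  have h1 := Real.GammaIntegral_convergent h0
  rw [Real.Gamma_eq_integral h0]
  simp only [add_sub_cancel_right] at h1 ⊢
  rw [ofReal_integral_eq_lintegral_ofReal h1]
  refine (ae_restrict_iff' measurableSet_Ioi).2 (ae_of_all _ fun t ht => ?_)
  have : (0:ℝ) < t := ht
  simp only [Pi.zero_apply]
  positivity

lemma lintegral_gamma_shift {s b : ℝ} (hs : -1 < s) :
    ∫⁻ t, (if b < t then ENNReal.ofReal (Real.exp (-t) * (t - b) ^ s) else 0) =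
      ENNReal.ofReal (Real.exp (-b)) * ENNReal.ofReal (Real.Gamma (s + 1)) := by
  rw [← lintegral_add_right_eq_self _ b, ← lintegral_gamma hs,
    ← lintegral_const_mul _ (by fun_prop), ← lintegral_indicator measurableSet_Ioi]
  congr 1
  ext t
  simp only [indicator, mem_Ioi, lt_add_iff_pos_left, add_sub_cancel_right]
  split_ifs
  · rw [← ENNReal.ofReal_mul (by positivity), ← mul_assoc, ← Real.exp_add]
    ring_nf
  · rfl


/-- auxiliary kernel -/
noncomputable def gk {d : ℕ} (σ : ℝ) (t : ℝ) (w : Cd d) : ℝ≥0∞ :=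
  if ‖w‖ ^ 2 < t then ENNReal.ofReal (Real.exp (-t) * (t - ‖w‖ ^ 2) ^ σ) else 0

lemma measurable_gk {d : ℕ} (σ : ℝ) : Measurable (Function.uncurry (gk (d := d) σ)) := by
  refine Measurable.ite ?_ (by fun_prop) measurable_const
  exact measurableSet_lt (by fun_prop) (by fun_prop)

lemma gk_scale {d : ℕ} {σ : ℝ} (k : ℕ) (h : Cd d → ℝ≥0∞)
    (hh : ∀ (r : ℝ), 0 < r → ∀ w, h (r • w) = ENNReal.ofReal (r ^ (2 * k)) * h w)
    {t : ℝ} (ht : 0 < t) (w : Cd d) :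
    gk σ t (Real.sqrt t • w) * h (Real.sqrt t • w) =
          ENNReal.ofReal (Real.exp (-t) * t ^ σ * t ^ (k:ℝ)) * (wt σ w * h w) := by
  rw [hh _ (Real.sqrt_pos.2 ht)]
  simp only [gk, wt, norm_smul, mul_pow, Real.norm_eq_abs, sq_abs, Real.sq_sqrt ht.le]
  have hiff : t * ‖w‖ ^ 2 < t ↔ ‖w‖ < 1 := by
    rw [mul_lt_iff_lt_one_right ht, sq_lt_one_iff₀ (norm_nonneg _)]
  simp only [hiff]
  split_ifs with hw
  · have : t - t * ‖w‖ ^ 2 = t * (1 - ‖w‖ ^ 2) := by ring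
    have h1 : 0 ≤ 1 - ‖w‖ ^ 2 := by nlinarith [norm_nonneg w]
    rw [this, Real.mul_rpow ht.le h1, pow_mul, Real.sq_sqrt ht.le, ← Real.rpow_natCast t k,
      ← mul_assoc, ← mul_assoc (ENNReal.ofReal _) (ENNReal.ofReal _) (h w),
      ← ENNReal.ofReal_mul (by positivity), ← ENNReal.ofReal_mul (by positivity)]
    congr 2
    ring
  · simp

lemma gk_int {d : ℕ} {σ : ℝ} (k : ℕ) (h : Cd d → ℝ≥0∞) (hm : Measurable h)
    (hh : ∀ (r : ℝ), 0 < r → ∀ w, h (r • w) = ENNReal.ofReal (r ^ (2 * k)) * h w)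
    (t : ℝ) : ∫⁻ w, gk σ t w * h w ∂(normVol d) = (Ioi (0:ℝ)).indicator
      (fun t => ENNReal.ofReal (Real.exp (-t) * t ^ (d + σ + k)) *
        ∫⁻ w, wt σ w * h w ∂(normVol d)) t := by
  have gm' : Measurable (gk (d := d) σ t) :=
    (measurable_gk σ).of_uncurry_left
  have gm2 : Measurable (fun w => gk σ t w * h w) := gm'.mul hm
  have wm2 : Measurable (fun w : Cd d => wt σ w * h w) := (measurable_wt σ).mul hm
  by_cases ht : 0 < t
  · rw [indicator_of_mem (by exact ht),
        lintegral_scale (Real.sqrt_pos.2 ht) _ gm2]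
    simp only [gk_scale k h hh ht]
    rw [lintegral_const_mul _ wm2, ← mul_assoc,
        ← ENNReal.ofReal_mul (by positivity), Real.rpow_add ht, Real.rpow_add ht,
        pow_mul, Real.sq_sqrt ht.le, ← Real.rpow_natCast t d]
    congr 2
    ring
  · rw [indicator_of_notMem (by exact ht)]
    have : ∀ w : Cd d, gk σ t w = 0 := by
      intro w
      simp only [gk]
      rw [if_neg]
      push Not at ht ⊢
      exact ht.trans (by positivity)
    simp [this]

lemma gk_int' {d : ℕ} {σ : ℝ} (hσ : -1 < σ) (h : Cd d → ℝ≥0∞) (w : Cd d) :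
    ∫⁻ t, gk σ t w * h w = ENNReal.ofReal (Real.Gamma (σ + 1)) *
      (ENNReal.ofReal (Real.exp (-‖w‖ ^ 2)) * h w) := by
  have gm : Measurable (fun t => gk σ t w) :=
    (measurable_gk σ).of_uncurry_right
  rw [lintegral_mul_const _ gm]
  simp only [gk]
  rw [lintegral_gamma_shift hσ]
  ring

/-- Laplace transform identity. -/
lemma laplace {d : ℕ} {σ : ℝ} (hσ : -1 < σ) (k : ℕ) (h : Cd d → ℝ≥0∞) (hm : Measurable h)
    (hh : ∀ (r : ℝ), 0 < r → ∀ w, h (r • w) = ENNReal.ofReal (r ^ (2 * k)) * h w) :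
    ENNReal.ofReal (Real.Gamma (d + 1 + σ + k)) * ∫⁻ w, wt σ w * h w ∂(normVol d) =
      ENNReal.ofReal (Real.Gamma (σ + 1)) *
        ∫⁻ w, ENNReal.ofReal (Real.exp (-‖w‖ ^ 2)) * h w ∂(normVol d) := by
  have swap : ∫⁻ t, ∫⁻ w, gk σ t w * h w ∂(normVol d) =
      ∫⁻ w, (∫⁻ t, gk σ t w * h w) ∂(normVol d) :=
    lintegral_lintegral_swap (((measurable_gk σ).mul (hm.comp measurable_snd)).aemeasurable)
  simp only [gk_int' hσ, gk_int k h hm hh] at swap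
  have m3 : Measurable (fun w : Cd d => ENNReal.ofReal (Real.exp (-‖w‖ ^ 2)) * h w) :=
    Measurable.mul (by fun_prop) hm
  have hd : (0:ℝ) ≤ d := by positivity
  have hk : (0:ℝ) ≤ k := by positivity
  rw [lintegral_indicator measurableSet_Ioi, lintegral_mul_const _ (by fun_prop),
    lintegral_gamma (by linarith), lintegral_const_mul _ m3] at swap
  rw [← swap]
  congr 3
  ring

end BergAux


namespace BergAux

open Filter Topology Set

lemma int_exp (k l : ℕ) : ∫ θ in Ioc (0:ℝ) (2 * Real.pi), cexp ((((k:ℂ) - l) * I) * θ) =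
    if k = l then ((2 * Real.pi : ℝ) : ℂ) else 0 := by
  rw [← intervalIntegral.integral_of_le (by positivity)]
  split_ifs with h
  · subst h; simp
  · rw [integral_exp_mul_complex]
    · have : ((k:ℂ) - l) * I * ((2 * Real.pi : ℝ) : ℂ) = ((k - l : ℤ) : ℂ) * (2 * Real.pi * I) := by
        push_cast; ring
      rw [this, Complex.exp_int_mul_two_pi_mul_I]
      simp
    · refine mul_ne_zero (sub_ne_zero.2 ?_) I_ne_zero
      exact_mod_cast h

lemma parseval (a : ℕ → ℂ) (f : ℝ → ℂ) (hs : Summable fun k => ‖a k‖)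
    (hf : ∀ θ : ℝ, HasSum (fun k => a k * cexp (θ * I) ^ k) (f θ)) :
    ∫⁻ θ in Ioc (0:ℝ) (2 * Real.pi), ‖f θ‖ₑ ^ 2 =
      ENNReal.ofReal (2 * Real.pi) * ∑' k, ‖a k‖ₑ ^ 2 := by
  let t : ℕ × ℕ → ℝ → ℂ := fun p θ =>
    (a p.1 * (starRingEnd ℂ) (a p.2)) * cexp ((((p.1:ℂ) - p.2) * I) * θ)
  have ht : ∀ p θ, t p θ = (a p.1 * cexp (θ * I) ^ p.1) *
      (starRingEnd ℂ) (a p.2 * cexp (θ * I) ^ p.2) := by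
    intro p θ
    simp only [t, map_mul, map_natCast, ← Complex.exp_conj, conj_I, conj_ofReal, ← Complex.exp_nat_mul]
    rw [mul_mul_mul_comm, ← Complex.exp_add]
    ring_nf
  have hnt : ∀ p θ, ‖t p θ‖ = ‖a p.1‖ * ‖a p.2‖ := by
    intro p θ
    have : ‖cexp (θ * I)‖ = 1 := Complex.norm_exp_ofReal_mul_I θ
    simp only [ht, norm_mul, RCLike.norm_conj, norm_pow, this, one_pow, mul_one]
  have hsp : Summable fun p : ℕ × ℕ => ‖a p.1‖ * ‖a p.2‖ :=
    hs.mul_of_nonneg hs (fun _ => norm_nonneg _) (fun _ => norm_nonneg _)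
  have hsum : ∀ θ, HasSum (fun p => t p θ) (f θ * (starRingEnd ℂ) (f θ)) := by
    intro θ
    have h2 : HasSum (fun k => (starRingEnd ℂ) (a k * cexp (θ * I) ^ k))
      ((starRingEnd ℂ) (f θ)) := (hf θ).map (starRingEnd ℂ) Complex.continuous_conj
    have := (hf θ).mul h2 (.of_norm (by simpa [ht] using (by simpa only [hnt] using hsp :
      Summable fun p => ‖t p θ‖)))
    simpa only [ht] using this
  have hcont : ∀ p, Continuous (t p) := by intro p; fun_prop
  have hint : ∀ p, Integrable (t p) (volume.restrict (Ioc (0:ℝ) (2 * Real.pi))) := by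
    intro p
    exact ((hcont p).integrableOn_Icc).mono_set Ioc_subset_Icc_self
  have key := hasSum_integral_of_summable_integral_norm hint (by
    simp only [hnt]
    simp only [integral_const, smul_eq_mul]
    exact hsp.mul_left _)
  have hfeq : ∀ θ, ∑' p, t p θ = ((‖f θ‖ ^ 2 : ℝ) : ℂ) := by
    intro θ
    rw [(hsum θ).tsum_eq, Complex.mul_conj, Complex.normSq_eq_norm_sq]
  have hti : ∀ p, ∫ θ in Ioc (0:ℝ) (2 * Real.pi), t p θ =
      if p.1 = p.2 then ((2 * Real.pi * ‖a p.1‖ ^ 2 : ℝ) : ℂ) else 0 := by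
    intro p
    simp only [t]
    rw [integral_const_mul, int_exp]
    split_ifs with h
    · rw [← h, Complex.mul_conj, Complex.normSq_eq_norm_sq]
      push_cast; ring
    · simp
  simp only [hfeq, hti] at key
  rw [integral_complex_ofReal] at key
  have hinj : Function.Injective (fun k : ℕ => (k, k)) := fun x y h => (Prod.mk.inj h).1
  have key2 := (hinj.hasSum_iff (fun p hp => by
    rw [if_neg]
    intro h
    exact hp ⟨p.1, by ext <;> simp [h]⟩)).2 key
  simp only [Function.comp_def, if_true] at key2
  have key3 : HasSum (fun k => 2 * Real.pi * ‖a k‖ ^ 2)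
      (∫ θ in Ioc (0:ℝ) (2 * Real.pi), ‖f θ‖ ^ 2) := by
    exact_mod_cast key2
  have hfint : Integrable (fun θ => ‖f θ‖ ^ 2)
      (volume.restrict (Ioc (0:ℝ) (2 * Real.pi))) := by
    have hc : Continuous f := by
      have : f = fun θ : ℝ => ∑' k, a k * cexp (θ * I) ^ k := by
        ext θ; exact (hf θ).tsum_eq.symm
      rw [this]
      refine continuous_tsum (fun k => by fun_prop) hs (fun k θ => ?_)
      have : ‖cexp (θ * I)‖ = 1 := Complex.norm_exp_ofReal_mul_I θ
      simp [this]
    exact ((by fun_prop : Continuous fun θ => ‖f θ‖ ^ 2).integrableOn_Icc).mono_set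
      Ioc_subset_Icc_self
  have e1 : ∫⁻ θ in Ioc (0:ℝ) (2 * Real.pi), ‖f θ‖ₑ ^ 2 =
      ENNReal.ofReal (∫ θ in Ioc (0:ℝ) (2 * Real.pi), ‖f θ‖ ^ 2) := by
    rw [ofReal_integral_eq_lintegral_ofReal hfint (ae_of_all _ fun θ => by positivity)]
    congr 1; ext θ
    rw [ENNReal.ofReal_pow (norm_nonneg _), ofReal_norm]
  rw [e1, ← key3.tsum_eq, ENNReal.ofReal_tsum_of_nonneg (fun k => by positivity) key3.summable,
    ← ENNReal.tsum_mul_left]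
  congr 1; ext k
  rw [ENNReal.ofReal_mul (by positivity), ENNReal.ofReal_pow (norm_nonneg _), ofReal_norm]

/-- Orthogonality in the ball for rotation invariant weights. -/
lemma rot_parseval {d : ℕ} (z : Cd d) (c : ℕ → ℂ) (F : ℂ → ℂ) (hFm : Measurable F)
    (g : Cd d → ℝ≥0∞) (hg : Measurable g)
    (hgr : ∀ (u : ℂ), ‖u‖ = 1 → ∀ w, g (u • w) = g w)
    (hs : ∀ w, g w ≠ 0 → Summable fun k => ‖c k‖ * ‖herm z w‖ ^ k)
    (hF : ∀ w, g w ≠ 0 → HasSum (fun k => c k * herm z w ^ k) (F (herm z w))) :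
    ∫⁻ w, ‖F (herm z w)‖ₑ ^ 2 * g w ∂(normVol d) =
      ∑' k, ‖c k‖ₑ ^ 2 * ∫⁻ w, ‖herm z w‖ₑ ^ (2 * k) * g w ∂(normVol d) := by
  have hm0 : Measurable (fun w => herm z w) := (continuous_herm z).measurable
  let Φ : Cd d → ℝ≥0∞ := fun w => ‖F (herm z w)‖ₑ ^ 2 * g w
  have hΦ : Measurable Φ := by
    exact ((hFm.comp hm0).enorm.pow_const 2).mul hg
  have h2pi : ENNReal.ofReal (2 * Real.pi) ≠ 0 := by
    simp [Real.pi_pos]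
  have hmeas : Measurable (Function.uncurry fun (θ : ℝ) (w : Cd d) =>
      Φ (cexp (-(θ * I)) • w)) := by
    refine hΦ.comp ?_
    apply Continuous.measurable
    fun_prop
  have hu : ∀ θ : ℝ, ‖cexp (-(θ * I))‖ = 1 := by
    intro θ
    have := Complex.norm_exp_ofReal_mul_I (-θ)
    simpa using this
  have step1 : ENNReal.ofReal (2 * Real.pi) * ∫⁻ w, Φ w ∂(normVol d) =
      ∫⁻ θ in Ioc (0:ℝ) (2 * Real.pi), ∫⁻ w, Φ (cexp (-(θ * I)) • w) ∂(normVol d) := by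
    have : ∀ θ : ℝ, ∫⁻ w, Φ (cexp (-(θ * I)) • w) ∂(normVol d) = ∫⁻ w, Φ w ∂(normVol d) :=
      fun θ => lintegral_rot (hu θ) Φ hΦ
    simp only [this, lintegral_const]
    simp [mul_comm]
  have step2 : ∀ w, ∫⁻ θ in Ioc (0:ℝ) (2 * Real.pi), Φ (cexp (-(θ * I)) • w) =
      ENNReal.ofReal (2 * Real.pi) * ∑' k, ‖c k‖ₑ ^ 2 * (‖herm z w‖ₑ ^ (2 * k) * g w) := by
    intro w
    have e : ∀ θ : ℝ, Φ (cexp (-(θ * I)) • w) = ‖F (cexp (θ * I) * herm z w)‖ₑ ^ 2 * g w := by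
      intro θ
      simp only [Φ]
      rw [hgr _ (hu θ), herm_smul_right, ← Complex.exp_conj]
      simp
    simp only [e]
    by_cases h0 : g w = 0
    · simp [h0]
    have hmθ : Measurable fun θ : ℝ => ‖F (cexp (θ * I) * herm z w)‖ₑ ^ 2 := by
      refine (hFm.comp ?_).enorm.pow_const 2
      fun_prop
    rw [lintegral_mul_const _ hmθ, parseval (fun k => c k * herm z w ^ k) _
      (by simpa using hs w h0), mul_assoc, ← ENNReal.tsum_mul_right]
    · congr 2; ext k
      rw [enorm_mul, mul_pow, enorm_pow, ← pow_mul, mul_assoc, mul_comm k 2]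
    · intro θ
      have hh : herm z (cexp (-(θ * I)) • w) = cexp (θ * I) * herm z w := by
        rw [herm_smul_right, ← Complex.exp_conj]; simp
      have := hF (cexp (-(θ * I)) • w) (by rwa [hgr _ (hu θ)])
      rw [hh] at this
      convert this using 2 with k
      rw [mul_pow]; ring
  have swap : ∫⁻ θ in Ioc (0:ℝ) (2 * Real.pi), ∫⁻ w, Φ (cexp (-(θ * I)) • w) ∂(normVol d) =
      ∫⁻ w, (∫⁻ θ in Ioc (0:ℝ) (2 * Real.pi), Φ (cexp (-(θ * I)) • w)) ∂(normVol d) :=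
    lintegral_lintegral_swap hmeas.aemeasurable
  have hmk : ∀ k : ℕ, Measurable fun w => ‖herm z w‖ₑ ^ (2 * k) * g w := by
    intro k
    exact (hm0.enorm.pow_const _).mul hg
  rw [swap] at step1
  simp only [step2] at step1
  rw [lintegral_const_mul _ (Measurable.tsum fun k => (hmk k).const_mul _),
    lintegral_tsum (fun k => ((hmk k).const_mul _).aemeasurable)] at step1
  have step3 := (ENNReal.mul_right_inj h2pi ENNReal.ofReal_ne_top).1 step1
  rw [show ∫⁻ w, ‖F (herm z w)‖ₑ ^ 2 * g w ∂(normVol d) = ∫⁻ w, Φ w ∂(normVol d) from rfl, step3]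
  congr 1; ext k
  rw [lintegral_const_mul _ (hmk k)]

end BergAux


namespace BergAux

open Filter Topology Set

lemma hs_congr {E : Type*} [NormedAddCommGroup E] {f g : ℕ → E} {a : E} (h : HasSum f a)
    (e : ∀ k, g k = f k) : HasSum g a := by
  have : g = f := funext e
  rwa [this]

lemma uniq (b : ℕ → ℝ) (h : ∀ x : ℝ, 0 < x → HasSum (fun k => b k * x ^ k) 0) : ∀ k, b k = 0 := by
  intro k
  induction k using Nat.strong_induction_on with
  | _ k ih =>
  have hsum1 : Summable b := by simpa using (h 1 one_pos).summable
  have hS : Summable fun j => ‖b (j + 1 + k)‖ := by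
    have := (summable_nat_add_iff (k + 1)).2 hsum1.norm
    refine this.congr fun j => ?_
    congr 2; ring
  have bound : ∀ x : ℝ, 0 < x → x < 1 → ‖b k‖ ≤ x * ∑' j, ‖b (j + 1 + k)‖ := by
    intro x hx hx1
    have h1 := (hasSum_nat_add_iff' k).2 (h x hx)
    rw [Finset.sum_eq_zero (fun i hi => by rw [ih i (Finset.mem_range.1 hi), zero_mul]),
      sub_zero] at h1
    have h2 : HasSum (fun j => b (j + k) * x ^ j) 0 := by
      have := h1.mul_right ((x ^ k)⁻¹)
      rw [zero_mul] at this
      refine hs_congr this fun j => ?_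
      rw [pow_add]
      field_simp
    have h3 := (hasSum_nat_add_iff' 1).2 h2
    simp only [Finset.sum_range_one, zero_add, pow_zero, mul_one, zero_sub] at h3
    have h4 := tsum_of_norm_bounded (hS.hasSum.mul_left x) (f := fun j => b (j + 1 + k) * x ^ (j + 1))
      (fun j => by
        rw [norm_mul, norm_pow, Real.norm_of_nonneg hx.le, pow_succ]
        have : x ^ j ≤ 1 := pow_le_one₀ hx.le hx1.le
        calc ‖b (j + 1 + k)‖ * (x ^ j * x) ≤ ‖b (j + 1 + k)‖ * (1 * x) := by gcongr
          _ = _ := by ring)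
    rw [h3.tsum_eq, norm_neg] at h4
    exact h4
  have hlim : Tendsto (fun x : ℝ => x * ∑' j, ‖b (j + 1 + k)‖) (𝓝[>] 0) (𝓝 0) := by
    have : Tendsto (fun x : ℝ => x * ∑' j, ‖b (j + 1 + k)‖) (𝓝 0)
        (𝓝 (0 * ∑' j, ‖b (j + 1 + k)‖)) := tendsto_id.mul_const _
    rw [zero_mul] at this
    exact this.mono_left nhdsWithin_le_nhds
  have hle : ‖b k‖ ≤ 0 := by
    refine ge_of_tendsto hlim ?_
    filter_upwards [Ioo_mem_nhdsGT (zero_lt_one' ℝ)] with x hx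
    exact bound x hx.1 hx.2
  simpa using hle

/-- The Gaussian weight. -/
noncomputable def gs {d : ℕ} (w : Cd d) : ℝ≥0∞ := ENNReal.ofReal (Real.exp (-‖w‖ ^ 2))

lemma measurable_gs {d : ℕ} : Measurable (gs : Cd d → ℝ≥0∞) := by
  unfold gs; fun_prop

lemma lintegral_gs (d : ℕ) :
    ∫⁻ w, gs w ∂(normVol d) = ENNReal.ofReal (Real.Gamma (d + 1)) := by
  have h := laplace (d := d) (σ := 0) (by norm_num) 0 (fun _ => 1) measurable_const (by simp)
  have h1 : ∫⁻ w : Cd d, wt 0 w ∂(normVol d) = 1 := by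
    have : (wt 0 : Cd d → ℝ≥0∞) = (unitBall d).indicator 1 := by
      ext w; simp [wt, indicator, unitBall]
    rw [this, lintegral_indicator_one (by exact measurableSet_ball)]
    exact normVol_ball d
  simp only [mul_one, h1] at h
  simpa [gs] using h.symm

lemma gauss_gen {d : ℕ} (z : Cd d) :
    ∑' k : ℕ, ENNReal.ofReal ((((k.factorial : ℝ))⁻¹) ^ 2) *
      ∫⁻ w, ‖herm z w‖ₑ ^ (2 * k) * gs w ∂(normVol d) =
    ENNReal.ofReal (Real.exp (‖z‖ ^ 2) * Real.Gamma (d + 1)) := by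
  have h := rot_parseval z (fun k => ((k.factorial : ℂ))⁻¹) cexp (by fun_prop) gs measurable_gs
    (fun u hu w => by simp [gs, norm_smul, hu])
    (fun w _ => by
      have := Real.summable_pow_div_factorial ‖herm z w‖
      refine this.congr fun k => ?_
      simp [div_eq_inv_mul])
    (fun w _ => by
      have := NormedSpace.expSeries_div_hasSum_exp (𝔸 := ℂ) (herm z w)
      rw [← Complex.exp_eq_exp_ℂ] at this
      refine hs_congr this fun k => ?_
      rw [div_eq_inv_mul])
  have h2 : ∀ k : ℕ, ‖((k.factorial : ℂ))⁻¹‖ₑ ^ 2 = ENNReal.ofReal ((((k.factorial : ℝ))⁻¹) ^ 2) := by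
    intro k
    rw [← ofReal_norm, ENNReal.ofReal_pow (by positivity)]
    simp
  simp only [h2] at h
  rw [← h]
  have h3 : ∀ w, ‖cexp (herm z w)‖ₑ ^ 2 * gs w = ENNReal.ofReal (Real.exp (‖z‖ ^ 2)) * gs (w - z) := by
    intro w
    rw [← ofReal_norm, ← ENNReal.ofReal_pow (by positivity), gs, gs,
      ← ENNReal.ofReal_mul (by positivity), ← ENNReal.ofReal_mul (by positivity), Complex.norm_exp,
      ← Real.exp_nat_mul, ← Real.exp_add, ← Real.exp_add, @norm_sub_sq ℂ, herm_eq]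
    congr 2
    simp only [RCLike.re_to_complex]
    push_cast; ring
  simp only [h3]
  have hms : Measurable (fun w => gs (w - z)) := measurable_gs.comp (measurable_sub_const z)
  rw [lintegral_const_mul _ hms,
    lintegral_sub_right_eq_self gs z, lintegral_gs, ENNReal.ofReal_mul (by positivity)]

lemma gauss_moment {d : ℕ} (z : Cd d) (k : ℕ) :
    ∫⁻ w, ‖herm z w‖ₑ ^ (2 * k) * gs w ∂(normVol d) =
      ENNReal.ofReal (k.factorial * Real.Gamma (d + 1) * ‖z‖ ^ (2 * k)) := by
  let M : ℕ → ℝ≥0∞ := fun k => ∫⁻ w, ‖herm z w‖ₑ ^ (2 * k) * gs w ∂(normVol d)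
  have hG : 0 < Real.Gamma ((d:ℝ) + 1) := Real.Gamma_pos_of_pos (by positivity)
  have gen : ∀ x : ℝ, 0 < x → ∑' k : ℕ, ENNReal.ofReal ((((k.factorial : ℝ))⁻¹) ^ 2 * x ^ k) * M k =
      ENNReal.ofReal (Real.exp (x * ‖z‖ ^ 2) * Real.Gamma (d + 1)) := by
    intro x hx
    have h := gauss_gen (((Real.sqrt x : ℝ) : ℂ) • z)
    rw [norm_smul, mul_pow] at h
    simp only [Complex.norm_real, Real.norm_eq_abs, sq_abs, Real.sq_sqrt hx.le] at h
    rw [← h]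
    congr 1; ext k
    rw [ENNReal.ofReal_mul (by positivity), mul_assoc]
    congr 1
    rw [← lintegral_const_mul]
    · congr 1; ext w
      rw [herm_smul_left, enorm_mul, mul_pow, mul_assoc]
      congr 1
      rw [← ofReal_norm, ← ENNReal.ofReal_pow (by positivity), Complex.norm_real,
        Real.norm_eq_abs, pow_mul, sq_abs, Real.sq_sqrt hx.le]
    · exact ((continuous_herm z).measurable.enorm.pow_const _).mul measurable_gs
  have hfin : ∀ k, M k ≠ ∞ := by
    intro k hk
    have h1 := gen 1 one_pos
    have h2 := ENNReal.le_tsum (f := fun k : ℕ =>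
      ENNReal.ofReal ((((k.factorial : ℝ))⁻¹) ^ 2 * 1 ^ k) * M k) k
    rw [h1] at h2
    simp only [hk] at h2
    rw [ENNReal.mul_top (by simp; positivity)] at h2
    exact absurd h2 (by simp)
  have hM : ∀ k, M k = ENNReal.ofReal (M k).toReal := fun k => (ENNReal.ofReal_toReal (hfin k)).symm
  have hsum : ∀ x : ℝ, 0 < x → HasSum (fun k : ℕ => (((k.factorial : ℝ))⁻¹) ^ 2 * (M k).toReal * x ^ k)
      (Real.exp (x * ‖z‖ ^ 2) * Real.Gamma (d + 1)) := by
    intro x hx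
    have h := gen x hx
    have h1 : ∀ k : ℕ, ENNReal.ofReal ((((k.factorial : ℝ))⁻¹) ^ 2 * x ^ k) * M k =
        ENNReal.ofReal ((((k.factorial : ℝ))⁻¹) ^ 2 * (M k).toReal * x ^ k) := by
      intro k
      conv_lhs => rw [hM k]
      rw [← ENNReal.ofReal_mul (by positivity)]
      ring_nf
    simp only [h1] at h
    have hsm : Summable (fun k : ℕ => (((k.factorial : ℝ))⁻¹) ^ 2 * (M k).toReal * x ^ k) := by
      have h5 : ∑' k : ℕ, ENNReal.ofReal ((((k.factorial : ℝ))⁻¹) ^ 2 * (M k).toReal * x ^ k) ≠ ∞ := by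
        rw [h]; exact ENNReal.ofReal_ne_top
      have := ENNReal.summable_toReal h5
      refine this.congr fun k => ?_
      rw [ENNReal.toReal_ofReal (by positivity)]
    rw [← ENNReal.ofReal_tsum_of_nonneg (fun k => by positivity) hsm] at h
    have := (ENNReal.ofReal_eq_ofReal_iff (tsum_nonneg fun k => by positivity) (by positivity)).1 h
    rw [← this]
    exact hsm.hasSum
  have hb := uniq (fun k => (((k.factorial : ℝ))⁻¹) ^ 2 * (M k).toReal -
      Real.Gamma (d + 1) * ((‖z‖ ^ 2) ^ k / k.factorial)) (fun x hx => by
    have h1 := hsum x hx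
    have h2 := NormedSpace.expSeries_div_hasSum_exp (𝔸 := ℝ) (x * ‖z‖ ^ 2)
    rw [← Real.exp_eq_exp_ℝ] at h2
    have h3 := h1.sub (h2.mul_right (Real.Gamma (d + 1)))
    rw [sub_self] at h3
    refine hs_congr h3 fun k => ?_
    rw [mul_pow]
    ring) k
  have hk : (k.factorial : ℝ) ≠ 0 := by positivity
  change M k = _
  rw [hM k]
  congr 1
  field_simp at hb
  rw [pow_mul]
  linear_combination hb

lemma ball_moment {d : ℕ} {σ : ℝ} (hσ : -1 < σ) (z : Cd d) (k : ℕ) :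
    ∫⁻ w, wt σ w * ‖herm z w‖ₑ ^ (2 * k) ∂(normVol d) =
      ENNReal.ofReal (k.factorial * Real.Gamma (σ + 1) * Real.Gamma (d + 1) * ‖z‖ ^ (2 * k) /
        Real.Gamma (d + 1 + σ + k)) := by
  have h := laplace hσ k (fun w => ‖herm z w‖ₑ ^ (2 * k))
    ((continuous_herm z).measurable.enorm.pow_const _) (fun r hr w => by
      have : r • w = (r : ℂ) • w := by simp
      rw [this, herm_smul_right, enorm_mul, mul_pow]
      congr 1
      rw [← ofReal_norm, ← ENNReal.ofReal_pow (by positivity)]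
      simp [abs_of_pos hr])
  have h2 : ∫⁻ w, ENNReal.ofReal (Real.exp (-‖w‖ ^ 2)) * ‖herm z w‖ₑ ^ (2 * k) ∂(normVol d) =
      ENNReal.ofReal (k.factorial * Real.Gamma (d + 1) * ‖z‖ ^ (2 * k)) := by
    rw [← gauss_moment]
    simp only [gs, mul_comm]
  rw [h2] at h
  have hG : 0 < Real.Gamma (σ + 1) := Real.Gamma_pos_of_pos (by linarith)
  have hG2 : 0 < Real.Gamma (d + 1 + σ + k) := Real.Gamma_pos_of_pos (by
    have : (0:ℝ) ≤ d := by positivity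
    have : (0:ℝ) ≤ k := by positivity
    linarith)
  rw [← ENNReal.mul_right_inj (a := ENNReal.ofReal (Real.Gamma (d + 1 + σ + k))) (by simpa using hG2)
    ENNReal.ofReal_ne_top, h, ← ENNReal.ofReal_mul hG2.le, ← ENNReal.ofReal_mul hG.le]
  congr 1
  field_simp

end BergAux


namespace BergAux

open Filter Topology Set

/-- Binomial coefficients of `(1-ζ)^{-a}`. -/
noncomputable def bc (a : ℝ) (k : ℕ) : ℝ := Real.Gamma (a + k) / (Real.Gamma a * k.factorial)

lemma bc_pos {a : ℝ} (ha : 0 < a) (k : ℕ) : 0 < bc a k := by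
  unfold bc
  have := Real.Gamma_pos_of_pos ha
  have := Real.Gamma_pos_of_pos (by positivity : 0 < a + k)
  positivity

lemma asc_eq {a : ℝ} (ha : 0 < a) (k : ℕ) :
    (ascPochhammer ℝ k).eval a = Real.Gamma (a + k) / Real.Gamma a := by
  have h0 := Real.Gamma_pos_of_pos ha
  induction k with
  | zero => simp [h0.ne']
  | succ k ih =>
    rw [ascPochhammer_succ_eval, ih]
    push_cast
    rw [← add_assoc, Real.Gamma_add_one (by positivity)]
    ring

lemma choose_eq_bc {a : ℝ} (ha : 0 < a) (k : ℕ) : Ring.choose (a + k - 1) k = bc a k := by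
  have h1 : Ring.choose (a + k - 1) k = Ring.multichoose a k := by
    rw [Ring.choose]; congr 1; ring
  have h2 := Ring.factorial_nsmul_multichoose_eq_ascPochhammer a k
  rw [Polynomial.ascPochhammer_smeval_eq_eval, asc_eq ha, nsmul_eq_mul] at h2
  have hk : (k.factorial : ℝ) ≠ 0 := by positivity
  rw [h1, bc, mul_comm (Real.Gamma a), ← div_div, eq_div_iff (Real.Gamma_pos_of_pos ha).ne',
    eq_div_iff hk, ]
  have h0 := Real.Gamma_pos_of_pos ha
  rw [eq_div_iff h0.ne'] at h2
  linear_combination h2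

lemma binom_hasSum {a : ℝ} (ha : 0 < a) {ζ : ℂ} (hζ : ‖ζ‖ < 1) :
    HasSum (fun k => (bc a k : ℂ) * ζ ^ k) (1 / (1 - ζ) ^ (a : ℂ)) := by
  have h := (Complex.one_div_one_sub_cpow_hasFPowerSeriesOnBall_zero (a : ℂ)).hasSum
    (y := ζ) (by simpa [← ofReal_norm] using hζ)
  rw [zero_add] at h
  refine hs_congr h fun k => ?_
  rw [← choose_eq_bc ha, Complex.ofReal_choose]
  simp [mul_comm]

lemma binom_hasSum_real {a : ℝ} (ha : 0 < a) {x : ℝ} (h0 : 0 ≤ x) (hx : x < 1) :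
    HasSum (fun k => bc a k * x ^ k) ((1 - x) ^ (-a)) := by
  have h := binom_hasSum ha (ζ := (x : ℂ)) (by simpa [abs_of_nonneg h0] using hx)
  have e : 1 / (1 - (x:ℂ)) ^ (a : ℂ) = (((1 - x) ^ (-a) : ℝ) : ℂ) := by
    rw [Real.rpow_neg (by linarith), Complex.ofReal_inv, Complex.ofReal_cpow (by linarith)]
    simp
  rw [e] at h
  exact_mod_cast h

lemma norm_binom (a : ℝ) (ζ : ℂ) : ‖1 / ζ ^ (a : ℂ)‖ = ‖ζ‖ ^ (-a) := by
  rw [norm_div, norm_one, Complex.norm_cpow_real, Real.rpow_neg (norm_nonneg _), one_div]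

lemma herm_lt {d : ℕ} {z w : Cd d} (hz : ‖z‖ < 1) (hw : ‖w‖ < 1) : ‖herm z w‖ < 1 := by
  have := norm_herm_le z w
  nlinarith [norm_nonneg z, norm_nonneg w]

/-- Main integral evaluation. -/
lemma main_int {d : ℕ} {σ : ℝ} (hσ : -1 < σ) {a : ℝ} (ha : 0 < a) (m : ℕ) {z : Cd d}
    (hz : ‖z‖ < 1) :
    ∫⁻ w, ENNReal.ofReal (‖1 - herm z w‖ ^ (-(2 * a))) *
        (wt σ w * ‖herm z w‖ₑ ^ (2 * m)) ∂(normVol d) =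
      ∑' k : ℕ, ENNReal.ofReal (bc a k ^ 2 * ((k + m).factorial * Real.Gamma (σ + 1) *
        Real.Gamma (d + 1) * ‖z‖ ^ (2 * (k + m)) / Real.Gamma (d + 1 + σ + (k + m : ℕ)))) := by
  have hmh : Measurable (fun w => herm z w) := (continuous_herm z).measurable
  have h := rot_parseval z (fun k => (bc a k : ℂ)) (fun ζ => 1 / (1 - ζ) ^ (a : ℂ))
    (by fun_prop) (fun w => wt σ w * ‖herm z w‖ₑ ^ (2 * m))
    ((measurable_wt σ).mul (hmh.enorm.pow_const _))
    (fun u hu w => by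
      have hu' : ‖u‖ₑ = 1 := by rw [← ofReal_norm, hu]; simp
      simp [wt, norm_smul, hu, herm_smul_right, enorm_mul, hu'])
    (fun w hw => by
      have hw1 : ‖w‖ < 1 := by
        by_contra hc
        simp [wt, hc] at hw
      have := (binom_hasSum_real ha (norm_nonneg (herm z w)) (herm_lt hz hw1)).summable
      refine this.congr fun k => ?_
      rw [Complex.norm_real, Real.norm_of_nonneg (bc_pos ha k).le])
    (fun w hw => by
      have hw1 : ‖w‖ < 1 := by
        by_contra hc
        simp [wt, hc] at hw
      exact binom_hasSum ha (herm_lt hz hw1))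
  have e1 : ∀ w, ‖1 / (1 - herm z w) ^ (a : ℂ)‖ₑ ^ 2 =
      ENNReal.ofReal (‖1 - herm z w‖ ^ (-(2 * a))) := by
    intro w
    rw [← ofReal_norm, norm_binom, ← ENNReal.ofReal_pow (by positivity), ← Real.rpow_natCast,
      ← Real.rpow_mul (norm_nonneg _)]
    congr 2
    push_cast; ring
  simp only [e1] at h
  rw [h]
  congr 1; ext k
  have e2 : ∀ w, ‖herm z w‖ₑ ^ (2 * k) * (wt σ w * ‖herm z w‖ₑ ^ (2 * m)) =
      wt σ w * ‖herm z w‖ₑ ^ (2 * (k + m)) := by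
    intro w; ring
  simp only [e2]
  rw [ball_moment hσ, ENNReal.ofReal_mul (by positivity), ← ofReal_norm, Complex.norm_real,
    Real.norm_of_nonneg (bc_pos ha k).le, ENNReal.ofReal_pow (bc_pos ha k).le]

end BergAux


namespace BergAux

open Filter Topology Set

lemma gamma_prod {s : ℝ} (hs : 0 < s) (k : ℕ) :
    ∏ j ∈ Finset.range (k + 1), (s + j) = (s + k) * Real.Gamma (s + k) / Real.Gamma s := by
  have h0 := Real.Gamma_pos_of_pos hs
  induction k with
  | zero => simp [h0.ne']
  | succ k ih =>
    rw [Finset.prod_range_succ, ih]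
    push_cast
    rw [← add_assoc, Real.Gamma_add_one (by positivity)]
    ring

/-- `Γ(s+k) / (k^{s-1} k!) → 1`. -/
lemma gamma_asymp {s : ℝ} (hs : 0 < s) :
    Tendsto (fun k : ℕ => Real.Gamma (s + k) / ((k:ℝ) ^ (s - 1) * k.factorial)) atTop (𝓝 1) := by
  have h0 := Real.Gamma_pos_of_pos hs
  have h1 := (Real.GammaSeq_tendsto_Gamma s).inv₀ h0.ne'
  have h2 : Tendsto (fun k : ℕ => (k:ℝ) / (k + s)) atTop (𝓝 1) := tendsto_natCast_div_add_atTop s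
  have h3 := (h2.mul h1).mul_const (Real.Gamma s)
  rw [one_mul, inv_mul_cancel₀ h0.ne'] at h3
  refine h3.congr' ?_
  filter_upwards [eventually_gt_atTop 0] with k hk
  have hk' : (0:ℝ) < k := by exact_mod_cast hk
  have hg := Real.Gamma_pos_of_pos (by positivity : 0 < s + k)
  rw [Real.GammaSeq, gamma_prod hs, Real.rpow_sub_one hk'.ne']
  have : (k:ℝ) ^ s ≠ 0 := by positivity
  have : (k.factorial : ℝ) ≠ 0 := by positivity
  have : (k + s) ≠ 0 := by positivity
  have : (s + k) ≠ 0 := by positivity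
  field_simp
  ring

/-- lower coefficients -/
noncomputable def Ac (a lam : ℝ) (n k : ℕ) : ℝ :=
  bc a k ^ 2 * (k + n).factorial / Real.Gamma (lam + n + k)

lemma Ac_ratio {a lam : ℝ} {n : ℕ} (hn : 0 < n) (hl : 0 < lam) (ha : 2 * a = lam + n) :
    Tendsto (fun k => Ac a lam n k / bc n k) atTop (𝓝 (Real.Gamma n / Real.Gamma a ^ 2)) := by
  have hn' : (0:ℝ) < n := by exact_mod_cast hn
  have ha0 : 0 < a := by linarith
  have h := (((gamma_asymp ha0).pow 2).mul (gamma_asymp (s := n + 1) (by positivity))).div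
    ((gamma_asymp hn').mul (gamma_asymp (s := lam + n) (by positivity))) (by norm_num)
  have h2 := h.const_mul (Real.Gamma n / Real.Gamma a ^ 2)
  norm_num at h2
  refine h2.congr' ?_
  filter_upwards [eventually_gt_atTop 0] with k hk
  have hk' : (0:ℝ) < k := by exact_mod_cast hk
  have g1 := Real.Gamma_pos_of_pos (by positivity : 0 < a + k)
  have g2 := Real.Gamma_pos_of_pos ha0
  have g3 := Real.Gamma_pos_of_pos hn'
  have g4 := Real.Gamma_pos_of_pos (by positivity : (0:ℝ) < n + k)
  have g5 := Real.Gamma_pos_of_pos (by positivity : (0:ℝ) < lam + n + k)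
  have hf : Real.Gamma (n + 1 + k) = (k + n).factorial := by
    rw [← Real.Gamma_nat_eq_factorial]; congr 1; push_cast; ring
  have e1 : ((k:ℝ) ^ (a - 1)) ^ 2 * (k:ℝ) ^ (n:ℝ) =
      (k:ℝ) ^ ((n:ℝ) - 1) * (k:ℝ) ^ (lam + n - 1) := by
    rw [← Real.rpow_natCast, ← Real.rpow_mul hk'.le, ← Real.rpow_add hk', ← Real.rpow_add hk']
    congr 1
    push_cast
    linarith
  have p1 : 0 < (k:ℝ) ^ (a - 1) := by positivity
  have p2 : 0 < (k:ℝ) ^ (n:ℝ) := by positivity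
  have p3 : 0 < (k:ℝ) ^ ((n:ℝ) - 1) := by positivity
  have p4 : 0 < (k:ℝ) ^ (lam + n - 1) := by positivity
  have p5 : (0:ℝ) < k.factorial := by positivity
  rw [Ac, bc, bc, hf]
  rw [← Real.rpow_natCast (k:ℝ) n] 
  generalize (k:ℝ) ^ (a - 1) = q1 at *
  generalize (k:ℝ) ^ (n:ℝ) = q2 at *
  generalize (k:ℝ) ^ ((n:ℝ) - 1) = q3 at *
  generalize (k:ℝ) ^ (lam + n - 1) = q4 at *
  field_simp
  linear_combination (-1) * e1

lemma Ac_summable {a lam : ℝ} {n : ℕ} (hn : 0 < n) (hl : 0 < lam) (ha : 2 * a = lam + n)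
    {x : ℝ} (h0 : 0 ≤ x) (h1 : x < 1) : Summable fun k => Ac a lam n k * x ^ k := by
  have hn' : (0:ℝ) < n := by exact_mod_cast hn
  obtain ⟨M, hM⟩ := (Ac_ratio hn hl ha).bddAbove_range
  refine Summable.of_nonneg_of_le (fun k => ?_) (fun k => ?_)
    ((binom_hasSum_real hn' h0 h1).summable.mul_left M)
  · unfold Ac
    have g5 := Real.Gamma_pos_of_pos (by positivity : (0:ℝ) < lam + n + k)
    positivity
  · have := hM ⟨k, rfl⟩
    simp only at this
    rw [div_le_iff₀ (bc_pos hn' k)] at this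
    rw [← mul_assoc]
    gcongr

lemma abel {a lam : ℝ} {n : ℕ} (hn : 0 < n) (hl : 0 < lam) (ha : 2 * a = lam + n)
    {L : ℝ} (hL : L < Real.Gamma n / Real.Gamma a ^ 2) :
    ∃ x : ℝ, 0 < x ∧ x < 1 ∧ L < (1 - x) ^ n * ∑' k, Ac a lam n k * x ^ k := by
  have hn' : (0:ℝ) < n := by exact_mod_cast hn
  obtain ⟨L2, hL1, hL2⟩ := exists_between hL
  obtain ⟨K, hK⟩ := eventually_atTop.1 ((Ac_ratio hn hl ha).eventually (lt_mem_nhds hL2))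
  let D := ∑ k ∈ Finset.range K, |L2| * bc n k
  have hlow : ∀ x : ℝ, 0 < x → x < 1 →
      L2 - D * (1 - x) ^ n ≤ (1 - x) ^ n * ∑' k, Ac a lam n k * x ^ k := by
    intro x hx hx1
    have hB := binom_hasSum_real hn' hx.le hx1
    have hA := (Ac_summable hn hl ha hx.le hx1).hasSum
    have hD : HasSum (fun k => if k ∈ Finset.range K then |L2| * bc n k else 0) D := by
      have e : D = ∑ k ∈ Finset.range K, if k ∈ Finset.range K then |L2| * bc n k else 0 :=
        Finset.sum_congr rfl fun k hk => (if_pos hk).symm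
      rw [e]
      exact hasSum_sum_of_ne_finset_zero (fun b hb => if_neg hb)
    have hle := hasSum_le (fun k => ?_) ((hB.mul_left L2).sub hD) hA
    · have hp : 0 < (1 - x) ^ n := pow_pos (by linarith) n
      have e : (1 - x) ^ (-(n:ℝ)) = ((1 - x) ^ n)⁻¹ := by
        rw [Real.rpow_neg (by linarith), Real.rpow_natCast]
      rw [e] at hle
      calc L2 - D * (1 - x) ^ n = (1 - x) ^ n * (L2 * ((1 - x) ^ n)⁻¹ - D) := by field_simp
        _ ≤ _ := by gcongr
    · have hb := bc_pos hn' k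
      have hxk : 0 < x ^ k := by positivity
      have hxk1 : x ^ k ≤ 1 := pow_le_one₀ hx.le hx1.le
      have g5 := Real.Gamma_pos_of_pos (by positivity : (0:ℝ) < lam + n + k)
      have hA0 : 0 ≤ Ac a lam n k := by unfold Ac; positivity
      by_cases hk : k < K
      · simp only [Finset.mem_range, hk, if_true]
        have h1 : L2 * (bc n k * x ^ k) ≤ |L2| * (bc n k * 1) := by
          have := le_abs_self L2
          gcongr
        have h2 : 0 ≤ Ac a lam n k * x ^ k := by positivity
        linarith
      · simp only [Finset.mem_range, hk, if_false, sub_zero]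
        have := (hK k (not_lt.1 hk)).le
        rw [le_div_iff₀ hb] at this
        rw [← mul_assoc]
        gcongr
  have hlim : Tendsto (fun x : ℝ => L2 - D * (1 - x) ^ n) (𝓝[<] 1) (𝓝 L2) := by
    have : Tendsto (fun x : ℝ => L2 - D * (1 - x) ^ n) (𝓝 1) (𝓝 (L2 - D * (1 - 1) ^ n)) :=
      Continuous.tendsto (by fun_prop) 1
    rw [sub_self, zero_pow hn.ne', mul_zero, sub_zero] at this
    exact this.mono_left nhdsWithin_le_nhds
  have hev := hlim.eventually (lt_mem_nhds hL1)
  obtain ⟨x, hx, hx2⟩ := (hev.and (Ioo_mem_nhdsLT (zero_lt_one' ℝ))).exists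
  exact ⟨x, hx2.1, hx2.2, hx.trans_le (hlow x hx2.1 hx2.2)⟩

lemma gamma_sq_le {a s t : ℝ} (hs : 0 < s) (ht : 0 < t) (h : 2 * a = s + t) :
    Real.Gamma a ^ 2 ≤ Real.Gamma s * Real.Gamma t := by
  have h1 := Real.Gamma_mul_add_mul_le_rpow_Gamma_mul_rpow_Gamma hs ht (a := 1/2) (b := 1/2)
    (by norm_num) (by norm_num) (by norm_num)
  have e : 1 / 2 * s + 1 / 2 * t = a := by linarith
  have gs := Real.Gamma_pos_of_pos hs
  have gt := Real.Gamma_pos_of_pos ht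
  have ga := Real.Gamma_pos_of_pos (by linarith : 0 < a)
  rw [e, ← Real.mul_rpow gs.le gt.le, ← Real.sqrt_eq_rpow] at h1
  calc Real.Gamma a ^ 2 ≤ Real.sqrt (Real.Gamma s * Real.Gamma t) ^ 2 := by gcongr
    _ = _ := Real.sq_sqrt (by positivity)

lemma upper_int {d n : ℕ} {σ a : ℝ} (hn : 0 < n) (hσ : -1 < σ) (ha : 2 * a = d + 1 + σ + n)
    {z : Cd d} (hz : ‖z‖ < 1) :
    ∫⁻ w, ENNReal.ofReal (‖1 - herm z w‖ ^ (-(2 * a))) * wt σ w ∂(normVol d) ≤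
      ENNReal.ofReal (Real.Gamma (σ + 1) * Real.Gamma (d + 1) * Real.Gamma n / Real.Gamma a ^ 2 *
        ((1 - ‖z‖ ^ 2) ^ n)⁻¹) := by
  have hn' : (0:ℝ) < n := by exact_mod_cast hn
  have hd' : (0:ℝ) ≤ d := by positivity
  have ha0 : 0 < a := by linarith
  have h := main_int hσ ha0 0 hz
  simp only [mul_zero, pow_zero, mul_one, add_zero] at h
  rw [h]
  have g1 := Real.Gamma_pos_of_pos (by linarith : 0 < σ + 1)
  have g2 := Real.Gamma_pos_of_pos (by positivity : 0 < (d:ℝ) + 1)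
  have g3 := Real.Gamma_pos_of_pos ha0
  have g4 := Real.Gamma_pos_of_pos hn'
  have hx1 : ‖z‖ ^ 2 < 1 := by nlinarith [norm_nonneg z]
  have hB := (binom_hasSum_real hn' (sq_nonneg ‖z‖) hx1).mul_left
    (Real.Gamma (σ + 1) * Real.Gamma (d + 1) * Real.Gamma n / Real.Gamma a ^ 2)
  have e : (1 - ‖z‖ ^ 2) ^ (-(n:ℝ)) = ((1 - ‖z‖ ^ 2) ^ n)⁻¹ := by
    rw [Real.rpow_neg (by linarith), Real.rpow_natCast]
  rw [e] at hB
  rw [← hB.tsum_eq, ENNReal.ofReal_tsum_of_nonneg (fun k => ?_) hB.summable]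
  · refine ENNReal.tsum_le_tsum fun k => ENNReal.ofReal_le_ofReal ?_
    have g5 := Real.Gamma_pos_of_pos (by linarith [(by positivity : (0:ℝ) ≤ k)] :
      (0:ℝ) < d + 1 + σ + k)
    have hk := gamma_sq_le (a := a + k) (s := n + k) (t := d + 1 + σ + k) (by positivity)
      (by linarith [(by positivity : (0:ℝ) ≤ k)]) (by linarith)
    have p5 : (0:ℝ) < k.factorial := by positivity
    rw [bc, bc, pow_mul]
    have q : 0 ≤ (‖z‖ ^ 2) ^ k := by positivity
    generalize (‖z‖ ^ 2) ^ k = y at *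
    calc (Real.Gamma (a + k) / (Real.Gamma a * k.factorial)) ^ 2 * (k.factorial * Real.Gamma (σ + 1) *
          Real.Gamma (d + 1) * y / Real.Gamma (d + 1 + σ + k))
        = Real.Gamma (a + k) ^ 2 * (Real.Gamma (σ + 1) * Real.Gamma (d + 1) * y /
          (Real.Gamma a ^ 2 * k.factorial * Real.Gamma (d + 1 + σ + k))) := by field_simp
      _ ≤ (Real.Gamma (n + k) * Real.Gamma (d + 1 + σ + k)) *
          (Real.Gamma (σ + 1) * Real.Gamma (d + 1) * y /
          (Real.Gamma a ^ 2 * k.factorial * Real.Gamma (d + 1 + σ + k))) := by gcongr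
      _ = _ := by field_simp
  · have := bc_pos hn' k
    positivity

lemma lower_int {d n : ℕ} {σ a : ℝ} (hn : 0 < n) (hσ : -1 < σ) (ha : 2 * a = d + 1 + σ + n)
    {L : ℝ} (hL : L < Real.Gamma n / Real.Gamma a ^ 2) :
    ∃ x : ℝ, 0 < x ∧ x < 1 ∧ ∃ S : ℝ, L < (1 - x) ^ n * S ∧ 0 ≤ S ∧ ∀ z : Cd d, ‖z‖ ^ 2 = x →
    ∫⁻ w, ENNReal.ofReal (‖1 - herm z w‖ ^ (-(2 * a))) *
        (wt σ w * ‖herm z w‖ₑ ^ (2 * n)) ∂(normVol d) =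
      ENNReal.ofReal (Real.Gamma (σ + 1) * Real.Gamma (d + 1) * x ^ n * S) := by
  have hn' : (0:ℝ) < n := by exact_mod_cast hn
  have hd' : (0:ℝ) ≤ d := by positivity
  have ha0 : 0 < a := by linarith
  have hl : (0:ℝ) < d + 1 + σ := by linarith
  have g1 := Real.Gamma_pos_of_pos (by linarith : 0 < σ + 1)
  have g2 := Real.Gamma_pos_of_pos (by positivity : 0 < (d:ℝ) + 1)
  obtain ⟨x, hx0, hx1, hx⟩ := abel hn hl ha hL
  have hAk : ∀ k, 0 ≤ Ac a (d + 1 + σ) n k := fun k => by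
    have g5 := Real.Gamma_pos_of_pos (by positivity : (0:ℝ) < d + 1 + σ + n + k)
    unfold Ac; positivity
  refine ⟨x, hx0, hx1, _, hx, tsum_nonneg fun k => mul_nonneg (hAk k) (by positivity), ?_⟩
  intro z hz
  have hz1 : ‖z‖ < 1 := by
    rw [← sq_lt_one_iff₀ (norm_nonneg z), hz]; exact hx1
  rw [main_int hσ ha0 n hz1]
  have hsm := (Ac_summable hn hl ha hx0.le hx1).mul_left
    (Real.Gamma (σ + 1) * Real.Gamma (d + 1) * x ^ n)
  rw [← tsum_mul_left, ENNReal.ofReal_tsum_of_nonneg (fun k => ?_) hsm]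
  · congr 1; ext k
    congr 1
    rw [pow_mul, hz, Ac, pow_add]
    have : (d:ℝ) + 1 + σ + ((k + n : ℕ) : ℝ) = d + 1 + σ + n + k := by push_cast; ring
    rw [this]
    ring
  · have := hAk k
    positivity

end BergAux

namespace BergAux
open Filter Topology Set

noncomputable def Kq {d : ℕ} (σ s : ℝ) (z w : Cd d) : ℂ :=
  (((1 - ‖w‖ ^ 2 : ℝ) ^ σ : ℝ) : ℂ) / (1 - herm z w) ^ ((s : ℝ) : ℂ)

noncomputable def BI {d : ℕ} (σ s : ℝ) (H : Cd d → ℂ) (z : Cd d) : ℂ :=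
  ∫ w in unitBall d, Kq σ s z w * H w ∂(normVol d)

lemma mem_ub {d : ℕ} {w : Cd d} : w ∈ unitBall d ↔ ‖w‖ < 1 := by
  simp [unitBall]

lemma measurableSet_ub {d : ℕ} : MeasurableSet (unitBall d) := measurableSet_ball

lemma wt_eq {d : ℕ} {σ : ℝ} {w : Cd d} :
    wt σ w = (unitBall d).indicator (fun w => ENNReal.ofReal ((1 - ‖w‖ ^ 2) ^ σ)) w := by
  simp only [wt, indicator, mem_ub]

lemma lint_wt {d : ℕ} {σ : ℝ} (f : Cd d → ℝ≥0∞) :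
    ∫⁻ w, f w * wt σ w ∂(normVol d) =
      ∫⁻ w in unitBall d, f w * ENNReal.ofReal ((1 - ‖w‖ ^ 2) ^ σ) ∂(normVol d) := by
  rw [← lintegral_indicator measurableSet_ub]
  congr 1; ext w
  rw [wt_eq]
  by_cases h : w ∈ unitBall d <;> simp [h]

lemma wt_integrable {d : ℕ} {σ : ℝ} (hσ : -1 < σ) :
    Integrable (fun w : Cd d => (1 - ‖w‖ ^ 2 : ℝ) ^ σ) ((normVol d).restrict (unitBall d)) := by
  have hm : Measurable (fun w : Cd d => (1 - ‖w‖ ^ 2 : ℝ) ^ σ) := by fun_prop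
  refine ⟨hm.aestronglyMeasurable, ?_⟩
  have h := ball_moment (d := d) hσ 0 0
  have h2 := lint_wt (d := d) (σ := σ) (fun _ => 1)
  simp only [mul_zero, pow_zero, mul_one] at h
  simp only [one_mul] at h2
  rw [hasFiniteIntegral_iff_ofReal, ← h2, h]
  · exact ENNReal.ofReal_lt_top
  · refine (ae_restrict_iff' measurableSet_ub).2 (ae_of_all _ fun w hw => ?_)
    have := mem_ub.1 hw
    have : 0 ≤ 1 - ‖w‖ ^ 2 := by nlinarith [norm_nonneg w]
    exact Real.rpow_nonneg this _

lemma one_sub_le {d : ℕ} {z w : Cd d} {ρ : ℝ} (hz : ‖z‖ ≤ ρ) (hw : ‖w‖ < 1) :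
    1 - ρ ≤ (1 - herm z w).re := by
  have := norm_herm_le z w
  have h2 := Complex.re_le_norm (herm z w)
  have : ‖z‖ * ‖w‖ ≤ ‖z‖ := by nlinarith [norm_nonneg z, norm_nonneg w]
  simp only [sub_re, one_re]
  linarith

lemma norm_Kq {d : ℕ} {σ s : ℝ} {z w : Cd d} (hw : ‖w‖ < 1) :
    ‖Kq σ s z w‖ = (1 - ‖w‖ ^ 2) ^ σ * ‖1 - herm z w‖ ^ (-s) := by
  have : 0 ≤ 1 - ‖w‖ ^ 2 := by nlinarith [norm_nonneg w]
  rw [← norm_binom, Kq, div_eq_mul_one_div, norm_mul, Complex.norm_real,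
    Real.norm_of_nonneg (Real.rpow_nonneg this _)]

lemma norm_Kq_le {d : ℕ} {σ s ρ : ℝ} (hs : 0 < s) {z w : Cd d} (hρ : ρ < 1) (hz : ‖z‖ ≤ ρ)
    (hw : ‖w‖ < 1) :
    ‖Kq σ s z w‖ ≤ (1 - ‖w‖ ^ 2) ^ σ * (1 - ρ) ^ (-s) := by
  have : 0 ≤ 1 - ‖w‖ ^ 2 := by nlinarith [norm_nonneg w]
  rw [norm_Kq hw]
  have h1 := one_sub_le hz hw
  have h2 := Complex.re_le_norm (1 - herm z w)
  have := Real.rpow_nonneg this σ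
  have h3 := Real.rpow_le_rpow_of_nonpos (by linarith : 0 < 1 - ρ) (h1.trans h2)
    (by linarith : -s ≤ 0)
  gcongr

lemma measurable_Kq {d : ℕ} (σ s : ℝ) (z : Cd d) : Measurable (fun w => Kq σ s z w) := by
  have := (continuous_herm z).measurable
  unfold Kq
  refine Measurable.div ?_ ?_
  · exact Complex.measurable_ofReal.comp (by fun_prop)
  · exact (measurable_const.sub this).pow_const _

lemma hasFDerivAt_Kq {d : ℕ} {σ s : ℝ} {z w : Cd d} (hz : ‖z‖ < 1) (hw : ‖w‖ < 1) :
    HasFDerivAt (fun z => Kq σ s z w) (((s : ℂ) * Kq σ (s + 1) z w) • innerSL ℂ w) z := by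
  have h1 : HasFDerivAt (fun z : Cd d => herm z w) (innerSL ℂ w) z := by
    have := (innerSL ℂ w).hasFDerivAt (x := z)
    simp only [herm_eq]
    exact this
  have hre := one_sub_le (le_refl ‖z‖) hw
  have hsl : 1 - herm z w ∈ Complex.slitPlane := Or.inl (by linarith)
  have h2 := (Complex.hasStrictDerivAt_cpow_const (c := -(s : ℂ)) hsl).hasDerivAt.comp_hasFDerivAt z
    (h1.const_sub 1)
  have h3 := h2.const_mul (((1 - ‖w‖ ^ 2 : ℝ) ^ σ : ℝ) : ℂ)
  have e1 : (fun z => Kq σ s z w) = fun z => (((1 - ‖w‖ ^ 2 : ℝ) ^ σ : ℝ) : ℂ) *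
      (((fun x : ℂ => x ^ (-(s : ℂ))) ∘ fun z => 1 - herm z w) z) := by
    ext z
    simp only [Kq, Function.comp, Complex.cpow_neg, div_eq_mul_inv]
  rw [e1]
  refine h3.congr_fderiv ?_
  ext v
  have e2 : (1 - herm z w) ^ (-(s : ℂ) - 1) = ((1 - herm z w) ^ ((s + 1 : ℝ) : ℂ))⁻¹ := by
    rw [← Complex.cpow_neg]; congr 1; push_cast; ring
  simp only [Kq, e2, ContinuousLinearMap.smul_apply, ContinuousLinearMap.neg_apply, smul_eq_mul,
    div_eq_mul_inv]
  ring

def good {d : ℕ} (H : Cd d → ℂ) : Prop := Measurable H ∧ ∀ w, ‖w‖ < 1 → ‖H w‖ ≤ 1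

lemma measurable_coord {d : ℕ} (j : Fin d) :
    Measurable (fun w : Cd d => (starRingEnd ℂ) (w j)) := by
  have : Continuous (fun w : Cd d => (starRingEnd ℂ) (w j)) := by fun_prop
  exact this.measurable

lemma norm_coord {d : ℕ} (j : Fin d) {w : Cd d} (hw : ‖w‖ < 1) :
    ‖(starRingEnd ℂ) (w j)‖ ≤ 1 := by
  rw [RCLike.norm_conj]
  exact (PiLp.norm_apply_le w j).trans hw.le

lemma good.mul_coord {d : ℕ} {H : Cd d → ℂ} (h : good H) (j : Fin d) :
    good (fun w => H w * (starRingEnd ℂ) (w j)) := by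
  refine ⟨h.1.mul (measurable_coord j), fun w hw => ?_⟩
  rw [norm_mul]
  exact mul_le_one₀ (h.2 w hw) (norm_nonneg _) (norm_coord j hw)

lemma int_Kq {d : ℕ} {σ s : ℝ} (hσ : -1 < σ) (hs : 0 < s) {H : Cd d → ℂ} (hH : good H)
    {z : Cd d} (hz : ‖z‖ < 1) :
    Integrable (fun w => Kq σ s z w * H w) ((normVol d).restrict (unitBall d)) := by
  refine Integrable.mono' ((wt_integrable hσ).mul_const ((1 - ‖z‖) ^ (-s)))
    ((measurable_Kq σ s z).mul hH.1).aestronglyMeasurable ?_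
  refine (ae_restrict_iff' measurableSet_ub).2 (ae_of_all _ fun w hw => ?_)
  rw [mem_ub] at hw
  rw [norm_mul]
  exact (mul_le_of_le_one_right (norm_nonneg _) (hH.2 w hw)).trans
    (norm_Kq_le hs hz le_rfl hw)

lemma hasFDerivAt_BI {d : ℕ} {σ s : ℝ} (hσ : -1 < σ) (hs : 0 < s) {H : Cd d → ℂ} (hH : good H)
    {z : Cd d} (hz : ‖z‖ < 1) :
    ∃ D : Cd d →L[ℂ] ℂ, HasFDerivAt (BI σ s H) D z ∧
      ∀ j, D (EuclideanSpace.single j 1) =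
        s * BI σ (s + 1) (fun w => H w * (starRingEnd ℂ) (w j)) z := by
  let ρ := (1 + ‖z‖) / 2
  have hρ : ρ < 1 := by simp only [ρ]; linarith
  have hzρ : ‖z‖ < ρ := by simp only [ρ]; linarith
  let F' : Cd d → Cd d → (Cd d →L[ℂ] ℂ) :=
    fun z w => ((s : ℂ) * (Kq σ (s + 1) z w * H w)) • innerSL ℂ w
  have hmeas : AEStronglyMeasurable (F' z) ((normVol d).restrict (unitBall d)) := by
    have h1 : Measurable (fun w => (s : ℂ) * (Kq σ (s + 1) z w * H w)) :=
      measurable_const.mul ((measurable_Kq σ (s + 1) z).mul hH.1)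
    exact h1.aestronglyMeasurable.smul (innerSL ℂ).continuous.aestronglyMeasurable
  have hb : ∀ w, ‖w‖ < 1 → ∀ x ∈ ball (0 : Cd d) ρ,
      ‖F' x w‖ ≤ s * ((1 - ‖w‖ ^ 2) ^ σ * (1 - ρ) ^ (-(s + 1))) := by
    intro w hw x hx
    have hx : ‖x‖ < ρ := by simpa using hx
    have h1 := norm_Kq_le (σ := σ) (by linarith : 0 < s + 1) hρ hx.le hw
    simp only [F']
    rw [norm_smul, innerSL_apply_norm, norm_mul, norm_mul, Complex.norm_real,
      Real.norm_of_nonneg hs.le, mul_assoc]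
    refine mul_le_mul_of_nonneg_left ?_ hs.le
    refine le_trans ?_ h1
    have := hH.2 w hw
    exact (mul_le_of_le_one_right (by positivity) hw.le).trans
      (mul_le_of_le_one_right (by positivity) this)
  have hbi : Integrable (fun w : Cd d => s * ((1 - ‖w‖ ^ 2) ^ σ * (1 - ρ) ^ (-(s + 1))))
      ((normVol d).restrict (unitBall d)) := ((wt_integrable hσ).mul_const _).const_mul _
  have key := hasFDerivAt_integral_of_dominated_of_fderiv_le (𝕜 := ℂ)
    (μ := (normVol d).restrict (unitBall d)) (F := fun z w => Kq σ s z w * H w) (F' := F')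
    (x₀ := z) (s := ball 0 ρ)
    (bound := fun w => s * ((1 - ‖w‖ ^ 2) ^ σ * (1 - ρ) ^ (-(s + 1))))
    (isOpen_ball.mem_nhds (by simpa using hzρ))
    (Eventually.of_forall fun x => ((measurable_Kq σ s x).mul hH.1).aestronglyMeasurable)
    (int_Kq hσ hs hH hz) hmeas
    ((ae_restrict_iff' measurableSet_ub).2 (ae_of_all _ fun w hw => hb w (mem_ub.1 hw)))
    hbi
    ((ae_restrict_iff' measurableSet_ub).2 (ae_of_all _ fun w hw x hx => by
      have hx : ‖x‖ < ρ := by simpa using hx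
      have := (hasFDerivAt_Kq (σ := σ) (s := s) (hx.trans hρ) (mem_ub.1 hw)).mul_const (H w)
      refine this.congr_fderiv ?_
      simp only [F', smul_smul]
      congr 1; ring))
  refine ⟨_, key, fun j => ?_⟩
  have hFi : Integrable (F' z) ((normVol d).restrict (unitBall d)) :=
    Integrable.mono' hbi hmeas ((ae_restrict_iff' measurableSet_ub).2
      (ae_of_all _ fun w hw => hb w (mem_ub.1 hw) z (by simpa using hzρ)))
  rw [ContinuousLinearMap.integral_apply hFi, BI, ← integral_const_mul]
  congr 1; ext w
  simp only [F', ContinuousLinearMap.smul_apply, innerSL_apply_apply, smul_eq_mul]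
  rw [EuclideanSpace.inner_single_right]
  ring

lemma pd_step {d : ℕ} {σ s : ℝ} (hσ : -1 < σ) (hs : 0 < s) {H : Cd d → ℂ} (hH : good H)
    {f : Cd d → ℂ} {c : ℂ} (hf : ∀ z, ‖z‖ < 1 → f z = c * BI σ s H z) (j : Fin d) :
    ∀ z, ‖z‖ < 1 → pd d j f z =
      (c * s) * BI σ (s + 1) (fun w => H w * (starRingEnd ℂ) (w j)) z := by
  intro z hz
  obtain ⟨D, hD, hDj⟩ := hasFDerivAt_BI hσ hs hH hz
  have e : f =ᶠ[𝓝 z] fun z => c * BI σ s H z := by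
    filter_upwards [isOpen_ball.mem_nhds (mem_ub.2 hz : z ∈ ball 0 1)] with x hx
    exact hf x (by simpa using hx)
  have h2 := (hD.const_mul c).congr_of_eventuallyEq e
  rw [pd, h2.fderiv, ContinuousLinearMap.smul_apply, hDj, smul_eq_mul, mul_assoc]

lemma good.mul_coord_pow {d : ℕ} {H : Cd d → ℂ} (h : good H) (j : Fin d) (k : ℕ) :
    good (fun w => H w * (starRingEnd ℂ) (w j) ^ k) := by
  induction k with
  | zero => simpa using h
  | succ k ih =>
    have := ih.mul_coord j
    simpa only [pow_succ, mul_assoc] using this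

lemma pd_iter {d : ℕ} {σ s : ℝ} (hσ : -1 < σ) (hs : 0 < s) {H : Cd d → ℂ} (hH : good H)
    {f : Cd d → ℂ} {c : ℂ} (hf : ∀ z, ‖z‖ < 1 → f z = c * BI σ s H z) (j : Fin d) (k : ℕ) :
    ∀ z, ‖z‖ < 1 → (pd d j)^[k] f z =
      (c * ((Real.Gamma (s + k) / Real.Gamma s : ℝ) : ℂ)) *
        BI σ (s + k) (fun w => H w * (starRingEnd ℂ) (w j) ^ k) z := by
  induction k with
  | zero =>
    intro z hz
    have := (Real.Gamma_pos_of_pos hs).ne'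
    simpa [div_self this] using hf z hz
  | succ k ih =>
    intro z hz
    have hk : 0 < s + k := by positivity
    rw [Function.iterate_succ_apply', pd_step hσ hk (hH.mul_coord_pow j k) ih j z hz]
    have e : s + (k:ℝ) + 1 = s + ((k + 1 : ℕ) : ℝ) := by push_cast; ring
    rw [← e, Real.Gamma_add_one hk.ne']
    simp only [pow_succ, mul_assoc]
    congr 1
    push_cast
    ring

lemma pd_fold {d : ℕ} {σ s : ℝ} (hσ : -1 < σ) (hs : 0 < s) {H : Cd d → ℂ} (hH : good H)
    {f : Cd d → ℂ} {c : ℂ} (hf : ∀ z, ‖z‖ < 1 → f z = c * BI σ s H z) (α : Fin d → ℕ)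
    (l : List (Fin d)) :
    good (fun w => H w * (l.map fun j => (starRingEnd ℂ) (w j) ^ α j).prod) ∧
    ∀ z, ‖z‖ < 1 → (l.foldr (fun j g => (pd d j)^[α j] g) f) z =
      (c * ((Real.Gamma (s + (l.map α).sum) / Real.Gamma s : ℝ) : ℂ)) *
        BI σ (s + (l.map α).sum)
          (fun w => H w * (l.map fun j => (starRingEnd ℂ) (w j) ^ α j).prod) z := by
  induction l with
  | nil =>
    refine ⟨by simpa using hH, fun z hz => ?_⟩
    have := (Real.Gamma_pos_of_pos hs).ne'
    simpa [div_self this] using hf z hz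
  | cons j l ih =>
    have hk : 0 < s + ((l.map α).sum : ℕ) := by positivity
    have e0 : (fun w : Cd d => H w * ((j :: l).map fun j => (starRingEnd ℂ) (w j) ^ α j).prod) =
        fun w => H w * (l.map fun j => (starRingEnd ℂ) (w j) ^ α j).prod *
          (starRingEnd ℂ) (w j) ^ α j := by
      ext w
      rw [List.map_cons, List.prod_cons]; ring
    refine ⟨?_, fun z hz => ?_⟩
    · rw [e0]; exact ih.1.mul_coord_pow j (α j)
    · rw [List.foldr_cons, pd_iter hσ hk ih.1 ih.2 j (α j) z hz, e0]
      have e : s + ((l.map α).sum : ℕ) + (α j : ℝ) = s + (((j :: l).map α).sum : ℕ) := by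
        rw [List.map_cons, List.sum_cons]; push_cast; ring
      rw [e]
      congr 1
      rw [mul_assoc, ← Complex.ofReal_mul]
      congr 2
      have := (Real.Gamma_pos_of_pos hk).ne'
      field_simp

lemma mpd_bergman {d n : ℕ} {σ : ℝ} (hσ : -1 < σ) {G : Cd d → ℂ} (hG : good G)
    (α : Fin d → ℕ) (hα : ∑ j, α j = n) {z : Cd d} (hz : ‖z‖ < 1) :
    good (fun w => G w * ∏ j, (starRingEnd ℂ) (w j) ^ α j) ∧
    mpd d α (bergman d σ G) z =
      ((Real.Gamma (d + 1 + σ + n) / (Real.Gamma (σ + 1) * Real.Gamma (d + 1)) : ℝ) : ℂ) *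
        BI σ (d + 1 + σ + n) (fun w => G w * ∏ j, (starRingEnd ℂ) (w j) ^ α j) z := by
  have hs : 0 < (d:ℝ) + 1 + σ := by
    have : (0:ℝ) ≤ d := by positivity
    linarith
  have h := pd_fold hσ hs hG (f := bergman d σ G) (c := (cCoef d σ : ℂ))
    (fun z _ => rfl) α (List.finRange d)
  simp only [← Fin.sum_univ_def, ← Fin.prod_univ_def, hα] at h
  refine ⟨h.1, ?_⟩
  rw [mpd, h.2 z hz]
  congr 1
  rw [← Complex.ofReal_mul]
  congr 1
  rw [cCoef]
  have := (Real.Gamma_pos_of_pos hs).ne'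
  rw [show (d:ℝ) + σ + 1 = d + 1 + σ by ring]
  field_simp

end BergAux

namespace BergAux
open Filter Topology Set

lemma BI_upper {d n : ℕ} {σ a : ℝ} (hn : 0 < n) (hσ : -1 < σ) (ha : 2 * a = d + 1 + σ + n)
    {H : Cd d → ℂ} (hH : good H) {z : Cd d} (hz : ‖z‖ < 1) :
    ‖BI σ (d + 1 + σ + n) H z‖ ≤
      Real.Gamma (σ + 1) * Real.Gamma (d + 1) * Real.Gamma n / Real.Gamma a ^ 2 *
        ((1 - ‖z‖ ^ 2) ^ n)⁻¹ := by
  have hu := upper_int hn hσ ha hz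
  have hn' : (0:ℝ) < n := by exact_mod_cast hn
  have ha0 : 0 < a := by
    have : (0:ℝ) ≤ d := by positivity
    linarith
  have g1 := Real.Gamma_pos_of_pos (by linarith : 0 < σ + 1)
  have g2 := Real.Gamma_pos_of_pos (by positivity : (0:ℝ) < d + 1)
  have g3 := Real.Gamma_pos_of_pos hn'
  have g4 := Real.Gamma_pos_of_pos ha0
  have hz2 : 0 < 1 - ‖z‖ ^ 2 := by nlinarith [norm_nonneg z]
  rw [lint_wt] at hu
  have h1 : ‖BI σ (d + 1 + σ + n) H z‖ₑ ≤ _ := (enorm_integral_le_lintegral_enorm _).trans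
    ((lintegral_mono_ae ((ae_restrict_iff' measurableSet_ub).2 (ae_of_all _ fun w hw => ?_))).trans hu)
  · rw [← ofReal_norm] at h1
    exact (ENNReal.ofReal_le_ofReal_iff (by positivity)).1 h1
  · rw [mem_ub] at hw
    rw [← ofReal_norm, ← ENNReal.ofReal_mul (by positivity)]
    refine ENNReal.ofReal_le_ofReal ?_
    rw [norm_mul, norm_Kq hw, ha, mul_comm (‖1 - herm z w‖ ^ _)]
    have : 0 ≤ 1 - ‖w‖ ^ 2 := by nlinarith [norm_nonneg w]
    have := Real.rpow_nonneg this σ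
    exact mul_le_of_le_one_right (by positivity) (hH.2 w hw)

noncomputable def extG (d n : ℕ) (s : ℝ) (j : Fin d) (z w : Cd d) : ℂ :=
  if ‖w‖ < 1 then (w j) ^ n * ((1 - herm z w) ^ (s : ℂ) / (‖(1 - herm z w) ^ (s : ℂ)‖ : ℝ)) else 0

lemma extG_good (d n : ℕ) (s : ℝ) (j : Fin d) (z : Cd d) :
    Measurable (extG d n s j z) ∧ ∀ w, ‖extG d n s j z w‖ ≤ 1 := by
  constructor
  · unfold extG
    refine Measurable.ite (measurableSet_lt (by fun_prop) (by fun_prop)) ?_ measurable_const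
    have h1 := (continuous_herm z).measurable
    have h2 : Measurable (fun w => (1 - herm z w) ^ (s : ℂ)) :=
      (measurable_const.sub h1).pow_const _
    have h3 : Continuous (fun w : Cd d => w j) := by fun_prop
    exact (h3.measurable.pow_const n).mul (h2.div (Complex.measurable_ofReal.comp h2.norm))
  · intro w
    unfold extG
    split_ifs with hw
    · rw [norm_mul, norm_pow]
      refine mul_le_one₀ (pow_le_one₀ (norm_nonneg _) ((PiLp.norm_apply_le w j).trans hw.le))
        (norm_nonneg _) ?_
      rw [norm_div, Complex.norm_real, norm_norm]
      exact div_self_le_one _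
    · simp

lemma BI_extG {d n : ℕ} {σ a : ℝ} (ha : 2 * a = d + 1 + σ + n)
    (j : Fin d) {x S C : ℝ} (hx : 0 < x) (hx1 : x < 1) (hS : 0 ≤ S) (hC : 0 ≤ C) {z : Cd d}
    (hz : z = EuclideanSpace.single j ((Real.sqrt x : ℝ) : ℂ))
    (hint : ∫⁻ w, ENNReal.ofReal (‖1 - herm z w‖ ^ (-(2 * a))) *
      (wt σ w * ‖herm z w‖ₑ ^ (2 * n)) ∂(normVol d) = ENNReal.ofReal (C * x ^ n * S)) :
    BI σ (d + 1 + σ + n) (fun w => extG d n (d + 1 + σ + n) j z w * (starRingEnd ℂ) (w j) ^ n) z =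
      ((C * S : ℝ) : ℂ) := by
  have hzn : ‖z‖ < 1 := by
    rw [hz, PiLp.norm_single, Complex.norm_real, Real.norm_of_nonneg (Real.sqrt_nonneg _)]
    rw [Real.sqrt_lt' one_pos]; simpa using hx1
  have hherm : ∀ w : Cd d, ‖herm z w‖ = Real.sqrt x * ‖w j‖ := by
    intro w
    rw [herm_eq, hz, EuclideanSpace.inner_single_right, norm_mul, Complex.norm_real,
      Real.norm_of_nonneg (Real.sqrt_nonneg _), RCLike.norm_conj]
  let f : Cd d → ℝ := fun w => (1 - ‖w‖ ^ 2) ^ σ * ‖1 - herm z w‖ ^ (-(2 * a)) * ‖w j‖ ^ (2 * n)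
  have e1 : BI σ (d + 1 + σ + n)
      (fun w => extG d n (d + 1 + σ + n) j z w * (starRingEnd ℂ) (w j) ^ n) z =
      ∫ w in unitBall d, ((f w : ℝ) : ℂ) ∂(normVol d) := by
    unfold BI
    refine setIntegral_congr_fun measurableSet_ub fun w hw => ?_
    rw [mem_ub] at hw
    have hne : 1 - herm z w ≠ 0 := by
      intro h
      have := one_sub_le (le_refl ‖z‖) hw
      rw [h] at this
      simp at this; linarith
    have hne2 : (1 - herm z w) ^ ((d + 1 + σ + n : ℝ) : ℂ) ≠ 0 := by
      simp [Complex.cpow_eq_zero_iff, hne]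
    have hcc : (w j) ^ n * (starRingEnd ℂ) (w j) ^ n = ((‖w j‖ ^ (2 * n) : ℝ) : ℂ) := by
      rw [← mul_pow, Complex.mul_conj, Complex.normSq_eq_norm_sq, pow_mul]; push_cast; rfl
    have hnn : ‖1 - herm z w‖ ^ (-(2 * a)) =
        ‖(1 - herm z w) ^ ((d + 1 + σ + n : ℝ) : ℂ)‖⁻¹ := by
      rw [ha, Complex.norm_cpow_real, Real.rpow_neg (norm_nonneg _)]
    simp only [extG, if_pos hw, Kq, f, hnn]
    rw [Complex.ofReal_mul, ← hcc]
    push_cast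
    push_cast at hne2
    field_simp
  rw [e1, integral_complex_ofReal]
  congr 1
  have hfm : Measurable f := by
    have h1 := (continuous_herm z).measurable
    have h3 : Continuous (fun w : Cd d => w j) := by fun_prop
    have h4 : Measurable (fun w : Cd d => (1 - ‖w‖ ^ 2 : ℝ) ^ σ) := by fun_prop
    exact (h4.mul ((measurable_const.sub h1).norm.pow_const _)).mul
      (h3.measurable.norm.pow_const _)
  have hf0 : ∀ w ∈ unitBall d, 0 ≤ f w := by
    intro w hw
    rw [mem_ub] at hw
    have : 0 ≤ 1 - ‖w‖ ^ 2 := by nlinarith [norm_nonneg w]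
    have := Real.rpow_nonneg this σ
    simp only [f]; positivity
  rw [integral_eq_lintegral_of_nonneg_ae
    ((ae_restrict_iff' measurableSet_ub).2 (ae_of_all _ hf0)) hfm.aestronglyMeasurable]
  have e2 : ∫⁻ w, ENNReal.ofReal (‖1 - herm z w‖ ^ (-(2 * a))) *
      (wt σ w * ‖herm z w‖ₑ ^ (2 * n)) ∂(normVol d) =
      ENNReal.ofReal (x ^ n) * ∫⁻ w in unitBall d, ENNReal.ofReal (f w) ∂(normVol d) := by
    rw [← lintegral_const_mul _ hfm.ennreal_ofReal, ← lintegral_indicator measurableSet_ub]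
    congr 1; ext w
    by_cases h : w ∈ unitBall d
    · have hw := mem_ub.1 h
      have h0 : 0 ≤ 1 - ‖w‖ ^ 2 := by nlinarith [norm_nonneg w]
      have h0 := Real.rpow_nonneg h0 σ
      rw [indicator_of_mem h, wt, if_pos hw, ← ofReal_norm, hherm,
        ← ENNReal.ofReal_pow (by positivity), ← ENNReal.ofReal_mul h0,
        ← ENNReal.ofReal_mul (by positivity), ← ENNReal.ofReal_mul (by positivity)]
      congr 1
      rw [mul_pow, pow_mul (Real.sqrt x), Real.sq_sqrt hx.le]
      simp only [f]; ring
    · rw [indicator_of_notMem h, wt, if_neg (fun hc => h (mem_ub.2 hc))]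
      simp
  rw [e2] at hint
  have h3 := congrArg ENNReal.toReal hint
  rw [ENNReal.toReal_mul, ENNReal.toReal_ofReal (by positivity),
    ENNReal.toReal_ofReal (by positivity)] at h3
  have hxn : x ^ n ≠ 0 := by positivity
  have : x ^ n * (∫⁻ w in unitBall d, ENNReal.ofReal (f w) ∂(normVol d)).toReal = x ^ n * (C * S) := by
    rw [h3]; ring
  exact mul_left_cancel₀ hxn this

end BergAux


/-- With the Bloch seminorm `‖f‖_𝓑 = sup_{z∈B} (1-|z|²)^n max_{|α|=n} |∂^α f(z)|`,
`‖T_σ‖_{L^∞(B)→𝓑} = Γ(λ+n)Γ(n)/Γ((λ+n)/2)²`. -/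
theorem bergman_projection_seminorm_sup
    (d n : ℕ) (hd : 0 < d) (hn : 0 < n) (σ : ℝ) (hσ : -1 < σ)
    (lam : ℝ) (hlam : lam = d + 1 + σ) :
    (⨆ G : {G : Cd d → ℂ // Measurable G ∧ ∀ w, ‖G w‖ ≤ 1},
        ⨆ z : unitBall d,
          (1 - ‖(z : Cd d)‖ ^ 2) ^ n *
            ⨆ α : MIdx d n, ‖mpd d α.1 (bergman d σ G.1) (z : Cd d)‖) =
      Real.Gamma (lam + n) * Real.Gamma n / Real.Gamma ((lam + n) / 2) ^ 2 := by
  have hn' : (0:ℝ) < n := by exact_mod_cast hn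
  have hd' : (0:ℝ) ≤ d := by positivity
  subst hlam
  obtain ⟨a, haa⟩ : ∃ a, a = ((d:ℝ) + 1 + σ + n) / 2 := ⟨_, rfl⟩
  rw [← haa]
  have ha : 2 * a = d + 1 + σ + n := by linarith
  have g1 := Real.Gamma_pos_of_pos (by linarith : 0 < σ + 1)
  have g2 := Real.Gamma_pos_of_pos (by positivity : (0:ℝ) < d + 1)
  have g3 := Real.Gamma_pos_of_pos hn'
  have g4 := Real.Gamma_pos_of_pos (by linarith : 0 < a)
  have g5 := Real.Gamma_pos_of_pos (by linarith : 0 < (d:ℝ) + 1 + σ + n)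
  let j0 : Fin d := ⟨0, hd⟩
  let α0 : MIdx d n := ⟨Pi.single j0 n, by simp⟩
  have hup : ∀ (G : {G : Cd d → ℂ // Measurable G ∧ ∀ w, ‖G w‖ ≤ 1}) (z : unitBall d),
      (1 - ‖(z : Cd d)‖ ^ 2) ^ n *
            ⨆ α : MIdx d n, ‖mpd d α.1 (bergman d σ G.1) (z : Cd d)‖ ≤
      Real.Gamma (d + 1 + σ + n) * Real.Gamma n / Real.Gamma a ^ 2 := by
    intro G z
    have hz := BergAux.mem_ub.1 z.2
    have hz2 : 0 < 1 - ‖(z : Cd d)‖ ^ 2 := by nlinarith [norm_nonneg (z : Cd d)]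
    have hp := pow_pos hz2 n
    haveI : Nonempty (MIdx d n) := ⟨α0⟩
    rw [← le_div_iff₀' hp]
    refine ciSup_le fun α => ?_
    obtain ⟨hg, he⟩ := BergAux.mpd_bergman hσ (G := G.1) ⟨G.2.1, fun w _ => G.2.2 w⟩ α.1 α.2 hz
    rw [he, norm_mul, Complex.norm_real, Real.norm_of_nonneg (by positivity)]
    refine (mul_le_mul_of_nonneg_left (BergAux.BI_upper hn hσ ha hg hz) (by positivity)).trans
      (le_of_eq ?_)
    field_simp
  haveI : Nonempty {G : Cd d → ℂ // Measurable G ∧ ∀ w, ‖G w‖ ≤ 1} :=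
    ⟨⟨fun _ => 0, measurable_const, by simp⟩⟩
  haveI : Nonempty (unitBall d) := ⟨⟨0, BergAux.mem_ub.2 (by simp)⟩⟩
  apply le_antisymm
  · exact ciSup_le fun G => ciSup_le fun z => hup G z
  · refine le_of_forall_lt fun L hL => ?_
    have hL' : L / Real.Gamma (d + 1 + σ + n) < Real.Gamma n / Real.Gamma a ^ 2 := by
      rw [div_lt_iff₀ g5]
      refine hL.trans_le (le_of_eq ?_)
      ring
    obtain ⟨x, hx, hx1, S, hLS, hS, hint⟩ := BergAux.lower_int hn hσ ha hL'
    let z : Cd d := EuclideanSpace.single j0 ((Real.sqrt x : ℝ) : ℂ)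
    have hzx : ‖z‖ ^ 2 = x := by
      simp only [z]
      rw [PiLp.norm_single, Complex.norm_real, Real.norm_of_nonneg (Real.sqrt_nonneg _),
        Real.sq_sqrt hx.le]
    have hz : ‖z‖ < 1 := by nlinarith [norm_nonneg z]
    have hE := BergAux.extG_good d n (d + 1 + σ + n) j0 z
    have hBI := BergAux.BI_extG (C := Real.Gamma (σ + 1) * Real.Gamma (d + 1)) ha j0 hx hx1 hS
      (by positivity) rfl (hint z hzx)
    let G : {G : Cd d → ℂ // Measurable G ∧ ∀ w, ‖G w‖ ≤ 1} := ⟨_, hE⟩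
    have hval : ‖mpd d α0.1 (bergman d σ G.1) z‖ = Real.Gamma (d + 1 + σ + n) * S := by
      obtain ⟨-, he⟩ := BergAux.mpd_bergman hσ (G := G.1) ⟨G.2.1, fun w _ => G.2.2 w⟩ α0.1 α0.2 hz
      have ep : ∀ w : Cd d, ∏ j, (starRingEnd ℂ) (w j) ^ α0.1 j = (starRingEnd ℂ) (w j0) ^ n := by
        intro w
        rw [Finset.prod_eq_single j0]
        · simp [α0]
        · intro j _ hj
          simp [α0, Pi.single_eq_of_ne hj]
        · simp
      simp only [ep] at he
      rw [he, hBI, ← Complex.ofReal_mul, Complex.norm_real, Real.norm_of_nonneg (by positivity)]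
      field_simp
    have hz2 : 0 < 1 - ‖z‖ ^ 2 := by rw [hzx]; linarith
    calc L < (1 - ‖z‖ ^ 2) ^ n * ‖mpd d α0.1 (bergman d σ G.1) z‖ := by
          rw [hval, hzx]
          rw [div_lt_iff₀ g5] at hLS
          refine hLS.trans_le (le_of_eq ?_)
          ring
      _ ≤ (1 - ‖z‖ ^ 2) ^ n * ⨆ α : MIdx d n, ‖mpd d α.1 (bergman d σ G.1) z‖ := by
          refine mul_le_mul_of_nonneg_left ?_ (pow_pos hz2 n).le
          exact le_ciSup (f := fun α : MIdx d n => ‖mpd d α.1 (bergman d σ G.1) z‖)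
            (Set.finite_range _).bddAbove α0
      _ ≤ ⨆ z : unitBall d, (1 - ‖(z : Cd d)‖ ^ 2) ^ n *
            ⨆ α : MIdx d n, ‖mpd d α.1 (bergman d σ G.1) (z : Cd d)‖ :=
          le_ciSup (f := fun z : unitBall d => (1 - ‖(z : Cd d)‖ ^ 2) ^ n *
            ⨆ α : MIdx d n, ‖mpd d α.1 (bergman d σ G.1) (z : Cd d)‖)
            ⟨_, Set.forall_mem_range.2 (hup G)⟩ ⟨z, BergAux.mem_ub.2 hz⟩
      _ ≤ _ := le_ciSup (f := fun G : {G : Cd d → ℂ // Measurable G ∧ ∀ w, ‖G w‖ ≤ 1} =>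
            ⨆ z : unitBall d, (1 - ‖(z : Cd d)‖ ^ 2) ^ n *
            ⨆ α : MIdx d n, ‖mpd d α.1 (bergman d σ G.1) (z : Cd d)‖)
            ⟨_, Set.forall_mem_range.2 fun G => ciSup_le (hup G)⟩ G
end
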